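/- arXiv:1602.03614 — 7 statements merged into one kernel-verified Lean document; each statement's English description precedes it below -/
import Mathlib

section
/- Let n < N be positive integers, set α = 8n, and for κ > 0 define the mass cutoff function φ_κ : ℝ^N × (-∞,0) → ℝ by φ_κ(x,t) = ( 1 − κ^{−2} (κ²/τ)^{3/4} ( ‖x‖² − α τ ) )₊⁴ where τ = −t and a₊ = max(a,0). Then φ_κ is twice continuously differentiable on ℝ^N × (-∞,0), and for every n-dimensional linear subspace L ⊆ ℝ^N with orthonormal basis e₁,…,eₙ, every x ∈ ℝ^N and every t < 0, ∂_t φ_κ(x,t) − Σ_{i=1}^{n} (Hess_x φ_κ)(x,t)[e_i, e_i] ≤ 0. -/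
open Real

noncomputable section

/-- The power `a₊ ^ (k + 2)` of the positive part is differentiable. -/
theorem hasDerivAt_max_zero_pow (k : ℕ) (s : ℝ) :
    HasDerivAt (fun a : ℝ => max a 0 ^ (k + 2)) ((k + 2 : ℝ) * max s 0 ^ (k + 1)) s := by
  rcases lt_trichotomy s 0 with hs | rfl | hs
  · rw [max_eq_right hs.le, zero_pow k.succ_ne_zero, mul_zero]
    refine (hasDerivAt_const s (0 : ℝ)).congr_of_eventuallyEq ?_
    filter_upwards [Iio_mem_nhds hs] with a ha
    rw [max_eq_right (Set.mem_Iio.1 ha).le, zero_pow (by lia)]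
  · rw [max_self, zero_pow k.succ_ne_zero, mul_zero, hasDerivAt_iff_isLittleO_nhds_zero]
    have h : (fun a : ℝ => a ^ (k + 2)) =o[nhds 0] fun a : ℝ => a := by
      simpa using Asymptotics.isLittleO_pow_pow (𝕜 := ℝ) (show 1 < k + 2 by lia)
    refine Asymptotics.IsBigO.trans_isLittleO (.of_bound 1 (.of_forall fun a => ?_)) h
    rcases le_total a 0 with ha | ha <;> simp [ha]
  · rw [max_eq_left hs.le]
    have h := hasDerivAt_pow (k + 2) s
    push_cast at h
    refine h.congr_of_eventuallyEq ?_
    filter_upwards [Ioi_mem_nhds hs] with a ha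
    rw [max_eq_left (Set.mem_Ioi.1 ha).le]

theorem contDiff_max_zero_pow (m k : ℕ) (hmk : m < k) :
    ContDiff ℝ m (fun a : ℝ => max a 0 ^ k) := by
  induction m generalizing k with
  | zero => exact contDiff_zero.2 (by fun_prop)
  | succ m ih =>
    obtain ⟨k, rfl⟩ : ∃ j, k = j + 2 := ⟨k - 2, by lia⟩
    push_cast
    refine contDiff_succ_iff_deriv.2
      ⟨fun a => (hasDerivAt_max_zero_pow k a).differentiableAt, by simp, ?_⟩
    rw [funext fun a => (hasDerivAt_max_zero_pow k a).deriv]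
    exact contDiff_const.mul (ih (k + 1) (by lia))

/-- The Hessian of the radial function `y ↦ p (A - B‖y‖²)` on the diagonal. -/
theorem iteratedFDeriv_two_comp_sub_mul_norm_sq {E : Type*} [NormedAddCommGroup E]
    [InnerProductSpace ℝ E] {p p' p'' : ℝ → ℝ} (hp : ∀ s, HasDerivAt p (p' s) s)
    (hp' : ∀ s, HasDerivAt p' (p'' s) s) (A B : ℝ) (x v : E) :
    iteratedFDeriv ℝ 2 (fun y : E => p (A - B * ‖y‖ ^ 2)) x ![v, v] =
      p'' (A - B * ‖x‖ ^ 2) * (2 * B * inner ℝ x v) ^ 2 -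
        2 * B * p' (A - B * ‖x‖ ^ 2) * ‖v‖ ^ 2 := by
  have hu (y : E) : HasFDerivAt (fun y : E => A - B * ‖y‖ ^ 2) ((-2 * B) • innerSL ℝ y) y := by
    refine (((hasStrictFDerivAt_norm_sq y).hasFDerivAt.const_mul B).const_sub A).congr_fderiv ?_
    ext w
    simp
    ring
  have hf : fderiv ℝ (fun y : E => p (A - B * ‖y‖ ^ 2)) =
      fun y => p' (A - B * ‖y‖ ^ 2) • ((-2 * B) • innerSL ℝ y) :=
    funext fun y => ((hp _).comp_hasFDerivAt y (hu y)).fderiv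
  have hg := ((hp' _).comp_hasFDerivAt x (hu x)).smul
    ((innerSL ℝ (E := E)).hasFDerivAt (x := x) |>.const_smul (-2 * B))
  rw [iteratedFDeriv_two_apply, hf]
  refine (congrArg (fun T : E →L[ℝ] E →L[ℝ] ℝ => T v v) hg.fderiv).trans ?_
  change p' (A - B * ‖x‖ ^ 2) * (-2 * B * inner ℝ v v) +
    p'' (A - B * ‖x‖ ^ 2) * (-2 * B * inner ℝ x v) * (-2 * B * inner ℝ x v) = _
  rw [real_inner_self_eq_norm_sq]
  ring

/-- The time derivative of the rescaling factor `κ⁻² (κ² / τ) ^ (3 / 4)`, where `τ = -t`. -/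
theorem hasDerivAt_cutoff_factor {κ t : ℝ} (hκ : 0 < κ) (ht : t < 0) :
    HasDerivAt (fun s : ℝ => (κ ^ 2)⁻¹ * (κ ^ 2 / (-s)) ^ ((3 : ℝ) / 4))
      (3 / 4 * ((κ ^ 2)⁻¹ * (κ ^ 2 / (-t)) ^ ((3 : ℝ) / 4)) / (-t)) t := by
  have hτ : 0 < -t := neg_pos.2 ht
  have hb : 0 < κ ^ 2 / (-t) := by positivity
  have h := (((hasDerivAt_const t (κ ^ 2)).div (hasDerivAt_neg t) hτ.ne').rpow_const
    (p := (3 : ℝ) / 4) (Or.inl hb.ne')).const_mul (κ ^ 2)⁻¹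
  refine h.congr_deriv ?_
  simp only [Pi.div_apply]
  rw [Real.rpow_sub_one hb.ne']
  have := hκ.ne'
  have := ht.ne
  field_simp
  ring

/-- The mass cutoff function `φ_κ(x,t) = (1 − κ^{−2}(κ²/τ)^{3/4}(‖x‖² − 8n·τ))₊⁴`, `τ = −t`,
is C² on `ℝ^N × (-∞,0)` and is a subsolution of the linearized flow:
`∂_t φ_κ − tr_L Hess φ_κ ≤ 0` for every `n`-dimensional subspace `L`. -/
theorem stmt_1 (n N : ℕ) (hn : 0 < n) (hnN : n < N) (κ : ℝ) (hκ : 0 < κ)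
    (φ : EuclideanSpace ℝ (Fin N) → ℝ → ℝ)
    (hφ : ∀ (x : EuclideanSpace ℝ (Fin N)) (t : ℝ),
      φ x t = (max (1 - (κ ^ 2)⁻¹ * (κ ^ 2 / (-t)) ^ ((3 : ℝ) / 4)
        * (‖x‖ ^ 2 - (8 * n : ℝ) * (-t))) 0) ^ 4) :
    ContDiffOn ℝ 2 (fun p : EuclideanSpace ℝ (Fin N) × ℝ => φ p.1 p.2)
      (Set.univ ×ˢ Set.Iio (0 : ℝ)) ∧
    ∀ (L : Submodule ℝ (EuclideanSpace ℝ (Fin N)))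
      (e : Fin n → EuclideanSpace ℝ (Fin N)),
      Orthonormal ℝ e → Submodule.span ℝ (Set.range e) = L →
      ∀ (x : EuclideanSpace ℝ (Fin N)) (t : ℝ), t < 0 →
        deriv (fun s => φ x s) t
            - ∑ i : Fin n, (iteratedFDeriv ℝ 2 (fun y => φ y t) x) ![e i, e i] ≤ 0 := by
  obtain rfl : φ = fun x t => max (1 - (κ ^ 2)⁻¹ * (κ ^ 2 / (-t)) ^ ((3 : ℝ) / 4)
      * (‖x‖ ^ 2 - (8 * n : ℝ) * (-t))) 0 ^ 4 := funext₂ hφ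
  refine ⟨?_, fun L e he _ x t ht => ?_⟩
  · refine (contDiff_max_zero_pow 2 4 (by norm_num)).comp_contDiffOn ?_
    intro q hq
    have hq : 0 < -q.2 := neg_pos.2 hq.2
    have hb : 0 < κ ^ 2 / (-q.2) := by positivity
    refine ContDiffAt.contDiffWithinAt ?_
    exact contDiffAt_const.sub ((contDiffAt_const.mul
      ((contDiffAt_const.div contDiffAt_snd.neg hq.ne').rpow_const_of_ne hb.ne')).mul
      ((contDiffAt_fst.norm_sq ℝ).sub (contDiffAt_const.mul contDiffAt_snd.neg)))
  · have hτ : 0 < -t := neg_pos.2 ht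
    have hderiv := (hasDerivAt_max_zero_pow 2 _).comp t
      (((hasDerivAt_cutoff_factor hκ ht).mul
        (((hasDerivAt_neg t).const_mul (8 * n : ℝ)).const_sub (‖x‖ ^ 2))).const_sub 1)
    have hB : 0 ≤ (κ ^ 2)⁻¹ * (κ ^ 2 / (-t)) ^ ((3 : ℝ) / 4) := by positivity
    have hHess (i : Fin n) := iteratedFDeriv_two_comp_sub_mul_norm_sq
      (hasDerivAt_max_zero_pow 2)
      (fun s => (hasDerivAt_max_zero_pow 1 s).const_mul (((2 : ℕ) : ℝ) + 2))
      (1 + (κ ^ 2)⁻¹ * (κ ^ 2 / (-t)) ^ ((3 : ℝ) / 4) * (8 * n * (-t)))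
      ((κ ^ 2)⁻¹ * (κ ^ 2 / (-t)) ^ ((3 : ℝ) / 4)) x (e i)
    refine (congrArg₂ (· - ·) hderiv.deriv rfl).trans_le ?_
    simp only [Pi.mul_apply]
    generalize (κ ^ 2)⁻¹ * (κ ^ 2 / (-t)) ^ ((3 : ℝ) / 4) = B at *
    have hu (y : EuclideanSpace ℝ (Fin N)) :
        1 - B * (‖y‖ ^ 2 - 8 * n * (-t)) = 1 + B * (8 * n * (-t)) - B * ‖y‖ ^ 2 := by ring
    simp only [hu, hHess, he.norm_eq_one]
    generalize 1 + B * (8 * n * (-t)) - B * ‖x‖ ^ 2 = u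
    have hm : 0 ≤ max u 0 := le_max_right u 0
    generalize max u 0 = m at *
    rw [Finset.sum_sub_distrib, Finset.sum_const, Finset.card_univ, Fintype.card_fin,
      nsmul_eq_mul, ← Finset.mul_sum]
    have hS : 0 ≤ ∑ i, (2 * B * inner ℝ x (e i)) ^ 2 :=
      Finset.sum_nonneg fun i _ => sq_nonneg _
    generalize ∑ i, (2 * B * inner ℝ x (e i)) ^ 2 = S at *
    have hmS : 0 ≤ m ^ 2 * S := by positivity
    have hmB : 0 ≤ m ^ 3 * (B * ‖x‖ ^ 2 / (-t)) := by positivity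
    have key : 3 / 4 * B / (-t) * (‖x‖ ^ 2 - 8 * n * (-t)) =
        3 / 4 * (B * ‖x‖ ^ 2 / (-t)) - 6 * n * B := by
      have := ht.ne
      field_simp
      ring
    rw [key]
    norm_num
    nlinarith
end
end

section
/- Let N ≥ 2 and ρ > 0, and let u : ℝ^{N−1} → ℝ be three times continuously differentiable on the ball B_ρ(0) ⊆ ℝ^{N−1}, with u(0) = 0, Du(0) = 0, and ρ^{−1} sup_{B_ρ}|u| + sup_{B_ρ}‖Du‖ + ρ sup_{B_ρ}‖D²u‖ + ρ² sup_{B_ρ}‖D³u‖ ≤ 1. Define the inverse projection map Φ : B_ρ(0) × ℝ → ℝ^N = ℝ^{N−1} × ℝ by Φ(x′,s) = (x′, u(x′)) + s·(−Du(x′), 1)/√(1+‖Du(x′)‖²). Then there is a constant c = c(N) such that for every 0 < r ≤ ρ and every (x′,s) ∈ B_r(0) × [−r,r]: ‖Φ(x′,s) − (x′,s)‖ ≤ c·r²/ρ, ‖DΦ(x′,s) − Id‖ ≤ c·r/ρ, and ‖D²Φ(x′,s)‖ ≤ c/ρ. -/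
open Real

noncomputable section

open Metric WithLp

section Auxiliary

variable {E F G : Type*} [NormedAddCommGroup E] [NormedSpace ℝ E] [NormedAddCommGroup F]
  [NormedSpace ℝ F] [NormedAddCommGroup G] [NormedSpace ℝ G]

/-- Precomposition with a linear contraction does not increase iterated derivatives. -/
theorem ContinuousLinearMap.norm_iteratedFDeriv_comp_right_le {f : E → F} {s : Set E}
    (hs : IsOpen s) {n : WithTop ℕ∞} (hf : ContDiffOn ℝ n f s) (g : G →L[ℝ] E) (hg : ‖g‖ ≤ 1)
    {x : G} (hx : g x ∈ s) {i : ℕ} (hi : i ≤ n) :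
    ‖iteratedFDeriv ℝ i (f ∘ g) x‖ ≤ ‖iteratedFDeriv ℝ i f (g x)‖ := by
  have hs' : IsOpen (g ⁻¹' s) := hs.preimage g.continuous
  rw [← iteratedFDerivWithin_of_isOpen i hs hx, ← iteratedFDerivWithin_of_isOpen i hs' hx,
    g.iteratedFDerivWithin_comp_right hf hs.uniqueDiffOn hs'.uniqueDiffOn hx hi]
  refine (ContinuousMultilinearMap.norm_compContinuousLinearMap_le _ _).trans ?_
  refine mul_le_of_le_one_right (norm_nonneg _) ?_
  exact Finset.prod_le_one (fun _ _ => norm_nonneg _) (fun _ _ => hg)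

theorem norm_le_mul_of_norm_fderiv_le_of_map_zero {f : E → F} {r K : ℝ}
    (hf : ∀ y ∈ ball (0 : E) r, DifferentiableAt ℝ f y) (h0 : f 0 = 0)
    (hK : ∀ y ∈ ball (0 : E) r, ‖fderiv ℝ f y‖ ≤ K) {x : E} (hx : x ∈ ball 0 r) :
    ‖f x‖ ≤ K * r := by
  have hr : 0 < r := pos_of_mem_ball hx
  have h := (convex_ball (0 : E) r).norm_image_sub_le_of_norm_fderiv_le hf hK
    (mem_ball_self hr) hx
  rw [h0, sub_zero, sub_zero] at h
  have hK0 : 0 ≤ K := (norm_nonneg _).trans (hK x hx)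
  exact h.trans (mul_le_mul_of_nonneg_left (mem_ball_zero_iff.1 hx).le hK0)

theorem ContDiff.exists_norm_iteratedFDeriv_le_on_closedBall [FiniteDimensional ℝ E] {f : E → F}
    {n : ℕ} (hf : ContDiff ℝ n f) (R : ℝ) :
    ∃ C : ℝ, 0 ≤ C ∧ ∀ i ≤ n, ∀ x ∈ closedBall (0 : E) R, ‖iteratedFDeriv ℝ i f x‖ ≤ C := by
  have : ProperSpace E := FiniteDimensional.proper ℝ E
  have h : ∀ i, ∃ C : ℝ, 0 ≤ C ∧
      (i ≤ n → ∀ x ∈ closedBall (0 : E) R, ‖iteratedFDeriv ℝ i f x‖ ≤ C) := by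
    intro i
    by_cases hi : i ≤ n
    · obtain ⟨C, hC⟩ := (isCompact_closedBall (0 : E) R).exists_bound_of_continuousOn
        (hf.continuous_iteratedFDeriv (m := i) (by exact_mod_cast hi)).continuousOn
      exact ⟨max C 0, le_max_right _ _, fun _ x hx => (hC x hx).trans (le_max_left _ _)⟩
    · exact ⟨0, le_rfl, fun h => absurd h hi⟩
  choose C hC0 hC using h
  refine ⟨∑ i ∈ Finset.range (n + 1), C i, Finset.sum_nonneg fun i _ => hC0 i, ?_⟩
  intro i hi x hx
  exact (hC i hi x hx).trans (Finset.single_le_sum (fun j _ => hC0 j)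
    (Finset.mem_range.2 (Nat.lt_succ_of_le hi)))

/-- Bounds for a function that is affine in the last coordinate. -/
theorem norm_iteratedFDeriv_fst_smul_add_snd_smul_le {u : E → ℝ} {h : E → F} {e : F}
    (he : ‖e‖ ≤ 1) {s : Set E} (hs : IsOpen s) {N : WithTop ℕ∞} (hu : ContDiffOn ℝ N u s)
    (hh : ContDiffOn ℝ N h s) {z : WithLp 2 (E × ℝ)} (hz : z.fst ∈ s) {n : ℕ} (hn : n ≤ N) :
    ‖iteratedFDeriv ℝ n (fun y : WithLp 2 (E × ℝ) => u y.fst • e + y.snd • h y.fst) z‖ ≤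
      ‖iteratedFDeriv ℝ n u z.fst‖ + ∑ i ∈ Finset.range (n + 1), (n.choose i : ℝ) *
        ‖iteratedFDeriv ℝ i (sndL 2 ℝ E ℝ) z‖ * ‖iteratedFDeriv ℝ (n - i) h z.fst‖ := by
  have hs' : IsOpen (fstL 2 ℝ E ℝ ⁻¹' s) := hs.preimage (fstL 2 ℝ E ℝ).continuous
  have hfst : ‖fstL 2 ℝ E ℝ‖ ≤ 1 :=
    ContinuousLinearMap.opNorm_le_bound _ zero_le_one fun y => by
      rw [one_mul]; exact norm_fst_le E y
  have hmaps : Set.MapsTo (fstL 2 ℝ E ℝ) (fstL 2 ℝ E ℝ ⁻¹' s) s := fun _ hy => hy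
  have hu' : ContDiffOn ℝ N (u ∘ fstL 2 ℝ E ℝ) (fstL 2 ℝ E ℝ ⁻¹' s) :=
    hu.comp (fstL 2 ℝ E ℝ).contDiff.contDiffOn hmaps
  have hh' : ContDiffOn ℝ N (h ∘ fstL 2 ℝ E ℝ) (fstL 2 ℝ E ℝ ⁻¹' s) :=
    hh.comp (fstL 2 ℝ E ℝ).contDiff.contDiffOn hmaps
  have hsnd : ContDiffOn ℝ N (sndL 2 ℝ E ℝ) (fstL 2 ℝ E ℝ ⁻¹' s) :=
    (sndL 2 ℝ E ℝ).contDiff.contDiffOn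
  have hz' : z ∈ fstL 2 ℝ E ℝ ⁻¹' s := hz
  have hmem : fstL 2 ℝ E ℝ ⁻¹' s ∈ nhds z := hs'.mem_nhds hz'
  let L : ℝ →L[ℝ] F := (ContinuousLinearMap.id ℝ ℝ).smulRight e
  have hL : ‖L‖ ≤ 1 := by
    refine ContinuousLinearMap.opNorm_le_bound _ zero_le_one fun y => ?_
    rw [one_mul]
    exact (norm_smul_le _ _).trans (mul_le_of_le_one_right (norm_nonneg _) he)
  have key := iteratedFDeriv_add_apply (i := n) (f := L ∘ (u ∘ fstL 2 ℝ E ℝ))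
    (g := fun y => sndL 2 ℝ E ℝ y • (h ∘ fstL 2 ℝ E ℝ) y)
    (L.contDiff.contDiffAt.comp z ((hu'.contDiffAt hmem).of_le hn))
    (((hsnd.smul hh').contDiffAt hmem).of_le hn)
  change ‖iteratedFDeriv ℝ n (L ∘ (u ∘ fstL 2 ℝ E ℝ) +
    fun y => sndL 2 ℝ E ℝ y • (h ∘ fstL 2 ℝ E ℝ) y) z‖ ≤ _
  rw [key]
  refine (norm_add_le _ _).trans (add_le_add ?_ ?_)
  · refine (L.norm_iteratedFDeriv_comp_left (hu'.contDiffAt hmem) hn).trans ?_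
    refine (mul_le_of_le_one_left (norm_nonneg _) hL).trans ?_
    exact (fstL 2 ℝ E ℝ).norm_iteratedFDeriv_comp_right_le hs hu hfst hz hn
  · have := norm_iteratedFDerivWithin_smul_le hsnd hh' hs'.uniqueDiffOn hz' hn
    rw [iteratedFDerivWithin_of_isOpen n hs' hz'] at this
    refine this.trans (Finset.sum_le_sum fun i _ => ?_)
    rw [iteratedFDerivWithin_of_isOpen i hs' hz', iteratedFDerivWithin_of_isOpen _ hs' hz']
    refine mul_le_mul_of_nonneg_left ?_ (by positivity)
    refine (fstL 2 ℝ E ℝ).norm_iteratedFDeriv_comp_right_le hs hh hfst hz (le_trans ?_ hn)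
    exact_mod_cast Nat.sub_le n i

theorem ContinuousLinearMap.iteratedFDeriv_two (g : E →L[ℝ] F) (x : E) :
    iteratedFDeriv ℝ 2 g x = 0 := by
  have h : fderiv ℝ g = fun _ => g := funext fun _ => g.fderiv
  rw [← norm_eq_zero, ← norm_iteratedFDeriv_fderiv, h, iteratedFDeriv_succ_const]
  simp

theorem Filter.EventuallyEq.derivatives_of_id_add {f ψ : E → E} {x : E}
    (h : f =ᶠ[nhds x] fun y => y + ψ y) (hψ : ContDiffAt ℝ 2 ψ x) :
    fderiv ℝ f x - ContinuousLinearMap.id ℝ E = fderiv ℝ ψ x ∧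
      iteratedFDeriv ℝ 2 f x = iteratedFDeriv ℝ 2 ψ x := by
  have h' : f =ᶠ[nhds x] ⇑(ContinuousLinearMap.id ℝ E) + ψ := h
  constructor
  · rw [h'.fderiv_eq, fderiv_add (ContinuousLinearMap.differentiableAt _)
      (hψ.differentiableAt (by norm_num)), ContinuousLinearMap.fderiv, add_sub_cancel_left]
  · rw [(h'.iteratedFDeriv ℝ 2).eq_of_nhds, iteratedFDeriv_add_apply
      (ContinuousLinearMap.contDiff _).contDiffAt hψ,
      ContinuousLinearMap.iteratedFDeriv_two, zero_add]

theorem norm_iteratedFDeriv_one_sndL_le (z : WithLp 2 (E × ℝ)) :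
    ‖iteratedFDeriv ℝ 1 (sndL 2 ℝ E ℝ) z‖ ≤ 1 := by
  rw [norm_iteratedFDeriv_one, ContinuousLinearMap.fderiv]
  refine ContinuousLinearMap.opNorm_le_bound _ zero_le_one fun y => ?_
  rw [one_mul]
  exact norm_snd_le E y

end Auxiliary

section InverseProjection

variable {E : Type*} [NormedAddCommGroup E] [InnerProductSpace ℝ E]

/-- The upward unit normal of a graph with slope `v`, minus the vertical unit vector. -/
def unitNormalSubVertical (v : E) : WithLp 2 (E × ℝ) :=
  toLp 2 (-((√(1 + ‖v‖ ^ 2))⁻¹ • v), (√(1 + ‖v‖ ^ 2))⁻¹ - 1)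

theorem unitNormalSubVertical_zero : unitNormalSubVertical (0 : E) = 0 := by
  simp [unitNormalSubVertical]

theorem contDiff_unitNormalSubVertical {n : WithTop ℕ∞} :
    ContDiff ℝ n (unitNormalSubVertical : E → WithLp 2 (E × ℝ)) := by
  have hpos : ∀ v : E, (0 : ℝ) < 1 + ‖v‖ ^ 2 := fun v => by positivity
  have h : ContDiff ℝ n fun v : E => (√(1 + ‖v‖ ^ 2))⁻¹ :=
    ((contDiff_const.add (contDiff_norm_sq ℝ)).sqrt fun v => (hpos v).ne').inv
      fun v => (Real.sqrt_pos.2 (hpos v)).ne'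
  exact (prodContinuousLinearEquiv 2 ℝ E ℝ).symm.contDiff.comp
    ((h.smul contDiff_id).neg.prodMk (h.sub contDiff_const))

variable [CompleteSpace E]

theorem norm_iteratedFDeriv_gradient (u : E → ℝ) (x : E) (n : ℕ) :
    ‖iteratedFDeriv ℝ n (gradient u) x‖ = ‖iteratedFDeriv ℝ (n + 1) u x‖ := by
  rw [← norm_iteratedFDeriv_fderiv]
  exact (InnerProductSpace.toDual ℝ E).symm.norm_iteratedFDeriv_comp_left (fderiv ℝ u) x n

theorem ContDiffOn.gradient_of_isOpen {u : E → ℝ} {s : Set E} {m n : WithTop ℕ∞}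
    (hu : ContDiffOn ℝ n u s) (hs : IsOpen s) (hmn : m + 1 ≤ n) :
    ContDiffOn ℝ m (gradient u) s :=
  (InnerProductSpace.toDual ℝ E).symm.contDiff.comp_contDiffOn (hu.fderiv_of_isOpen hs hmn)

/-- Bounds for the normal field of a graph in terms of bounds for the unit normal map. -/
theorem norm_iteratedFDeriv_normal_le {u : E → ℝ} {ρ C : ℝ}
    (hu : ContDiffOn ℝ 3 u (ball 0 ρ))
    (h1 : ∀ x ∈ ball (0 : E) ρ, ‖fderiv ℝ u x‖ ≤ 1)
    (h2 : ∀ x ∈ ball (0 : E) ρ, ‖iteratedFDeriv ℝ 2 u x‖ ≤ ρ⁻¹)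
    (h3 : ∀ x ∈ ball (0 : E) ρ, ‖iteratedFDeriv ℝ 3 u x‖ ≤ ρ⁻¹ ^ 2)
    (hC : ∀ i ≤ 2, ∀ v ∈ closedBall (0 : E) 1,
      ‖iteratedFDeriv ℝ i (unitNormalSubVertical : E → WithLp 2 (E × ℝ)) v‖ ≤ C)
    {n : ℕ} (hn : n ≤ 2) {x : E} (hx : x ∈ ball 0 ρ) :
    ‖iteratedFDeriv ℝ n (unitNormalSubVertical ∘ gradient u) x‖ ≤ n.factorial * C * ρ⁻¹ ^ n := by
  have hgx : gradient u x ∈ closedBall (0 : E) 1 := by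
    rw [mem_closedBall_zero_iff]
    refine le_trans (le_of_eq ?_) (h1 x hx)
    exact (InnerProductSpace.toDual ℝ E).symm.norm_map _
  rw [← iteratedFDerivWithin_of_isOpen n isOpen_ball hx]
  refine norm_iteratedFDerivWithin_comp_le (N := 2) (t := Set.univ)
    contDiff_unitNormalSubVertical.contDiffOn
    (hu.gradient_of_isOpen isOpen_ball (by norm_num)) (by exact_mod_cast hn) uniqueDiffOn_univ
    isOpen_ball.uniqueDiffOn (Set.mapsTo_univ _ _) hx ?_ ?_
  · intro i hi
    rw [iteratedFDerivWithin_univ]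
    exact hC i (hi.trans hn) _ hgx
  · intro i hi hin
    rw [iteratedFDerivWithin_of_isOpen i isOpen_ball hx, norm_iteratedFDeriv_gradient]
    obtain rfl | rfl : i = 1 ∨ i = 2 := by omega
    · simpa using h2 x hx
    · exact h3 x hx

/-- The displacement `Φ - id` of the inverse projection map of the graph of `u`. -/
def inverseProjectionDisplacement (u : E → ℝ) (z : WithLp 2 (E × ℝ)) : WithLp 2 (E × ℝ) :=
  u z.fst • toLp 2 ((0 : E), (1 : ℝ)) + z.snd • (unitNormalSubVertical ∘ gradient u) z.fst

theorem contDiffAt_inverseProjectionDisplacement {u : E → ℝ} {s : Set E} (hs : IsOpen s)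
    (hu : ContDiffOn ℝ 3 u s) {z : WithLp 2 (E × ℝ)} (hz : z.fst ∈ s) :
    ContDiffAt ℝ 2 (inverseProjectionDisplacement u) z := by
  have hg : ContDiffAt ℝ 2 (gradient u) z.fst :=
    (hu.gradient_of_isOpen hs (by norm_num)).contDiffAt (hs.mem_nhds hz)
  have hu' : ContDiffAt ℝ 2 u z.fst := (hu.contDiffAt (hs.mem_nhds hz)).of_le (by norm_num)
  have hh : ContDiffAt ℝ 2 (unitNormalSubVertical ∘ gradient u) z.fst :=
    contDiff_unitNormalSubVertical.contDiffAt.comp _ hg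
  have hfst : ContDiffAt ℝ 2 (fstL 2 ℝ E ℝ) z := (fstL 2 ℝ E ℝ).contDiff.contDiffAt
  have hsnd : ContDiffAt ℝ 2 (sndL 2 ℝ E ℝ) z := (sndL 2 ℝ E ℝ).contDiff.contDiffAt
  exact ((hu'.comp z hfst).smul contDiffAt_const).add (hsnd.smul (hh.comp z hfst))

theorem inverseProjectionDisplacement_bounds {u : E → ℝ} {ρ C : ℝ} (hρ : 0 < ρ) (hC0 : 0 ≤ C)
    (hu : ContDiffOn ℝ 3 u (ball 0 ρ)) (hu0 : u 0 = 0) (hg0 : gradient u 0 = 0)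
    (h1 : ∀ x ∈ ball (0 : E) ρ, ‖fderiv ℝ u x‖ ≤ 1)
    (h2 : ∀ x ∈ ball (0 : E) ρ, ‖iteratedFDeriv ℝ 2 u x‖ ≤ ρ⁻¹)
    (h3 : ∀ x ∈ ball (0 : E) ρ, ‖iteratedFDeriv ℝ 3 u x‖ ≤ ρ⁻¹ ^ 2)
    (hC : ∀ i ≤ 2, ∀ v ∈ closedBall (0 : E) 1,
      ‖iteratedFDeriv ℝ i (unitNormalSubVertical : E → WithLp 2 (E × ℝ)) v‖ ≤ C)
    {r : ℝ} (hr : r ≤ ρ) {z : WithLp 2 (E × ℝ)} (hz : z.fst ∈ ball 0 r) (hs : |z.snd| ≤ r) :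
    ‖inverseProjectionDisplacement u z‖ ≤ (1 + 4 * C) * r ^ 2 / ρ ∧
      ‖fderiv ℝ (inverseProjectionDisplacement u) z‖ ≤ (1 + 4 * C) * r / ρ ∧
      ‖iteratedFDeriv ℝ 2 (inverseProjectionDisplacement u) z‖ ≤ (1 + 4 * C) / ρ := by
  have hr0 : 0 < r := pos_of_mem_ball hz
  have hsub : ball (0 : E) r ⊆ ball 0 ρ := ball_subset_ball hr
  have hg : ContDiffOn ℝ 2 (gradient u) (ball 0 ρ) :=
    hu.gradient_of_isOpen isOpen_ball (by norm_num)
  have hh : ContDiffOn ℝ 2 (unitNormalSubVertical ∘ gradient u) (ball 0 ρ) :=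
    contDiff_unitNormalSubVertical.comp_contDiffOn hg
  have hdiff : ∀ {F : Type _} [NormedAddCommGroup F] [NormedSpace ℝ F] {f : E → F},
      ContDiffOn ℝ 2 f (ball 0 ρ) → ∀ y ∈ ball (0 : E) r, DifferentiableAt ℝ f y :=
    fun hf y hy => (hf.contDiffAt (isOpen_ball.mem_nhds (hsub hy))).differentiableAt (by norm_num)
  have hu2 : ContDiffOn ℝ 2 u (ball 0 ρ) := hu.of_le (by norm_num)
  have hbound := fun {n : ℕ} (hn : n ≤ 2) {y : E} (hy : y ∈ ball (0 : E) ρ) =>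
    norm_iteratedFDeriv_normal_le hu h1 h2 h3 hC hn hy
  have hgr : ∀ y ∈ ball (0 : E) r, ‖fderiv ℝ u y‖ ≤ ρ⁻¹ * r := by
    intro y hy
    rw [← (InnerProductSpace.toDual ℝ E).symm.norm_map]
    refine norm_le_mul_of_norm_fderiv_le_of_map_zero (f := gradient u) (hdiff hg) hg0
      (fun w hw => ?_) hy
    rw [← norm_iteratedFDeriv_one, norm_iteratedFDeriv_gradient]
    exact h2 w (hsub hw)
  have hur : ‖u z.fst‖ ≤ ρ⁻¹ * r * r :=
    norm_le_mul_of_norm_fderiv_le_of_map_zero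
      (fun y hy => (hu2.contDiffAt (isOpen_ball.mem_nhds (hsub hy))).differentiableAt (by norm_num))
      hu0 hgr hz
  have hn0 : ‖(unitNormalSubVertical ∘ gradient u) z.fst‖ ≤ C * ρ⁻¹ * r := by
    refine norm_le_mul_of_norm_fderiv_le_of_map_zero (hdiff hh) ?_ (fun y hy => ?_) hz
    · rw [Function.comp_apply, hg0, unitNormalSubVertical_zero]
    · rw [← norm_iteratedFDeriv_one]
      simpa using hbound (n := 1) (by norm_num) (hsub hy)
  have hn1 : ‖iteratedFDeriv ℝ 1 (unitNormalSubVertical ∘ gradient u) z.fst‖ ≤ C * ρ⁻¹ := by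
    simpa using hbound (n := 1) (by norm_num) (hsub hz)
  have hn2 : ‖iteratedFDeriv ℝ 2 (unitNormalSubVertical ∘ gradient u) z.fst‖ ≤
      2 * C * ρ⁻¹ ^ 2 := by
    simpa using hbound (n := 2) le_rfl (hsub hz)
  have he : ‖toLp 2 ((0 : E), (1 : ℝ))‖ ≤ 1 := by simp
  have key := fun {n : ℕ} (hn : (n : WithTop ℕ∞) ≤ 2) =>
    norm_iteratedFDeriv_fst_smul_add_snd_smul_le he isOpen_ball hu2 hh (hsub hz) hn
  have hsnd0 : ‖iteratedFDeriv ℝ 0 (sndL 2 ℝ E ℝ) z‖ ≤ r := by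
    rw [norm_iteratedFDeriv_zero]; exact hs
  have hsnd1 := norm_iteratedFDeriv_one_sndL_le z
  have hρ' : 0 < ρ⁻¹ := inv_pos.2 hρ
  refine ⟨?_, ?_, ?_⟩
  · rw [← norm_iteratedFDeriv_zero (𝕜 := ℝ)]
    refine (key (n := 0) (by norm_num)).trans ?_
    simp only [Finset.sum_range_succ, Finset.sum_range_zero, Nat.choose_self, Nat.sub_zero,
      norm_iteratedFDeriv_zero, Nat.cast_one, one_mul, zero_add] at hsnd0 ⊢
    have := mul_le_mul hsnd0 hn0 (norm_nonneg _) hr0.le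
    have h4 : 0 ≤ C * ρ⁻¹ * r * r := by positivity
    rw [div_eq_mul_inv]
    nlinarith
  · rw [← norm_iteratedFDeriv_one]
    refine (key (n := 1) (by norm_num)).trans ?_
    simp only [Finset.sum_range_succ, Finset.sum_range_zero, Nat.choose_self,
      Nat.choose_zero_right, Nat.sub_zero, Nat.cast_one, one_mul, zero_add]
    rw [norm_iteratedFDeriv_one u, norm_iteratedFDeriv_zero (f := unitNormalSubVertical ∘ _)]
    have ha := mul_le_mul hsnd0 hn1 (norm_nonneg _) hr0.le
    have hb := mul_le_mul hsnd1 hn0 (norm_nonneg _) zero_le_one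
    have hc := hgr _ hz
    have h4 : 0 ≤ C * ρ⁻¹ * r := by positivity
    rw [div_eq_mul_inv]
    nlinarith
  · refine (key (n := 2) (by norm_num)).trans ?_
    simp only [Finset.sum_range_succ, Finset.sum_range_zero, Nat.choose_self,
      Nat.choose_zero_right, Nat.sub_zero, Nat.cast_one, one_mul, zero_add, Nat.choose_one_right,
      ContinuousLinearMap.iteratedFDeriv_two, norm_zero, mul_zero, zero_mul, add_zero,
      Nat.add_one_sub_one, Nat.cast_ofNat]
    have ha := mul_le_mul hsnd0 hn2 (norm_nonneg _) hr0.le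
    have hb := mul_le_mul hsnd1 hn1 (norm_nonneg _) zero_le_one
    have hc := h2 _ (hsub hz)
    have h5 : r * ρ⁻¹ ≤ 1 := by rwa [← div_eq_mul_inv, div_le_one hρ]
    have h6 : r * (2 * C * ρ⁻¹ ^ 2) ≤ 2 * C * ρ⁻¹ := by
      have := mul_le_mul_of_nonneg_left h5 (by positivity : 0 ≤ 2 * C * ρ⁻¹)
      nlinarith
    rw [div_eq_mul_inv]
    nlinarith

end InverseProjection

/-- Estimates for the inverse projection map `Φ(x′,s) = (x′, u(x′)) + s·ν(x′)` of the graph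
of `u : B_ρ(0) ⊆ ℝ^{N−1} → ℝ`, where `ν(x′) = (−Du(x′),1)/√(1+‖Du(x′)‖²)`: if `u` is C³ on
`B_ρ(0)` with `u(0) = 0`, `Du(0) = 0` and scale-invariant C³ bounds, then there is `c = c(N)`
with `‖Φ − Id‖ ≤ cr²/ρ`, `‖DΦ − Id‖ ≤ cr/ρ`, `‖D²Φ‖ ≤ c/ρ` on `B_r(0) × [−r,r]` for `r ≤ ρ`.
Here `ℝ^N` is identified with `ℝ^{N−1} × ℝ` carrying the Euclidean (`ℓ²`) norm. -/
theorem stmt_7 (N : ℕ) (hN : 2 ≤ N) :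
    ∃ c : ℝ, 0 < c ∧
      ∀ ρ : ℝ, 0 < ρ →
      ∀ u : EuclideanSpace ℝ (Fin (N - 1)) → ℝ,
        ContDiffOn ℝ 3 u (Metric.ball 0 ρ) →
        u 0 = 0 → gradient u 0 = 0 →
        (∀ x ∈ Metric.ball (0 : EuclideanSpace ℝ (Fin (N - 1))) ρ,
          ρ⁻¹ * |u x| + ‖fderiv ℝ u x‖ + ρ * ‖iteratedFDeriv ℝ 2 u x‖
            + ρ ^ 2 * ‖iteratedFDeriv ℝ 3 u x‖ ≤ 1) →
      ∀ Φ : WithLp 2 (EuclideanSpace ℝ (Fin (N - 1)) × ℝ)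
          → WithLp 2 (EuclideanSpace ℝ (Fin (N - 1)) × ℝ),
        (∀ x' ∈ Metric.ball (0 : EuclideanSpace ℝ (Fin (N - 1))) ρ, ∀ s : ℝ,
          Φ ((WithLp.equiv 2 (EuclideanSpace ℝ (Fin (N - 1)) × ℝ)).symm (x', s))
            = (WithLp.equiv 2 (EuclideanSpace ℝ (Fin (N - 1)) × ℝ)).symm
                (x' - (s / Real.sqrt (1 + ‖gradient u x'‖ ^ 2)) • gradient u x',
                 u x' + s / Real.sqrt (1 + ‖gradient u x'‖ ^ 2))) →
      ∀ r : ℝ, 0 < r → r ≤ ρ →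
      ∀ x' ∈ Metric.ball (0 : EuclideanSpace ℝ (Fin (N - 1))) r, ∀ s : ℝ, |s| ≤ r →
        ‖Φ ((WithLp.equiv 2 (EuclideanSpace ℝ (Fin (N - 1)) × ℝ)).symm (x', s))
            - (WithLp.equiv 2 (EuclideanSpace ℝ (Fin (N - 1)) × ℝ)).symm (x', s)‖
          ≤ c * r ^ 2 / ρ ∧
        ‖fderiv ℝ Φ ((WithLp.equiv 2 (EuclideanSpace ℝ (Fin (N - 1)) × ℝ)).symm (x', s))
            - ContinuousLinearMap.id ℝ (WithLp 2 (EuclideanSpace ℝ (Fin (N - 1)) × ℝ))‖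
          ≤ c * r / ρ ∧
        ‖iteratedFDeriv ℝ 2 Φ
            ((WithLp.equiv 2 (EuclideanSpace ℝ (Fin (N - 1)) × ℝ)).symm (x', s))‖
          ≤ c / ρ := by
  obtain ⟨C, hC0, hC⟩ := ContDiff.exists_norm_iteratedFDeriv_le_on_closedBall (n := 2)
    (contDiff_unitNormalSubVertical (E := EuclideanSpace ℝ (Fin (N - 1)))) 1
  refine ⟨1 + 4 * C, by positivity, ?_⟩
  intro ρ hρ u hu hu0 hg0 hbd Φ hΦ r hr hrρ x hx s hs
  have h1 : ∀ y ∈ ball (0 : EuclideanSpace ℝ (Fin (N - 1))) ρ, ‖fderiv ℝ u y‖ ≤ 1 := by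
    intro y hy
    have : 0 ≤ ρ⁻¹ * |u y| + ρ * ‖iteratedFDeriv ℝ 2 u y‖
      + ρ ^ 2 * ‖iteratedFDeriv ℝ 3 u y‖ := by positivity
    linarith [hbd y hy]
  have h2 : ∀ y ∈ ball (0 : EuclideanSpace ℝ (Fin (N - 1))) ρ,
      ‖iteratedFDeriv ℝ 2 u y‖ ≤ ρ⁻¹ := by
    intro y hy
    have : 0 ≤ ρ⁻¹ * |u y| + ‖fderiv ℝ u y‖ + ρ ^ 2 * ‖iteratedFDeriv ℝ 3 u y‖ := by positivity
    rw [← one_div, le_div_iff₀' hρ]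
    linarith [hbd y hy]
  have h3 : ∀ y ∈ ball (0 : EuclideanSpace ℝ (Fin (N - 1))) ρ,
      ‖iteratedFDeriv ℝ 3 u y‖ ≤ ρ⁻¹ ^ 2 := by
    intro y hy
    have : 0 ≤ ρ⁻¹ * |u y| + ‖fderiv ℝ u y‖ + ρ * ‖iteratedFDeriv ℝ 2 u y‖ := by positivity
    rw [inv_pow, ← one_div, le_div_iff₀' (by positivity)]
    linarith [hbd y hy]
  set z : WithLp 2 (EuclideanSpace ℝ (Fin (N - 1)) × ℝ) := (WithLp.equiv 2 _).symm (x, s)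
  have hzρ : z.fst ∈ ball (0 : EuclideanSpace ℝ (Fin (N - 1))) ρ := ball_subset_ball hrρ hx
  have hΦeq : ∀ y : WithLp 2 (EuclideanSpace ℝ (Fin (N - 1)) × ℝ), y.fst ∈ ball 0 ρ →
      Φ y = y + inverseProjectionDisplacement u y := by
    intro y hy
    refine (hΦ y.fst hy y.snd).trans ?_
    apply (WithLp.equiv 2 _).injective
    refine Prod.ext ?_ ?_
    · simp [inverseProjectionDisplacement, unitNormalSubVertical, div_eq_mul_inv, mul_smul,
        sub_eq_add_neg]
    · simp [inverseProjectionDisplacement, unitNormalSubVertical, div_eq_mul_inv]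
      ring
  have hev : Φ =ᶠ[nhds z] fun y => y + inverseProjectionDisplacement u y :=
    Filter.eventuallyEq_of_mem ((isOpen_ball.preimage
      (fstL 2 ℝ (EuclideanSpace ℝ (Fin (N - 1))) ℝ).continuous).mem_nhds hzρ) hΦeq
  obtain ⟨hD, hD2⟩ := hev.derivatives_of_id_add
    (contDiffAt_inverseProjectionDisplacement isOpen_ball hu hzρ)
  rw [hD, hD2, hΦeq z hzρ, add_sub_cancel_left]
  exact inverseProjectionDisplacement_bounds hρ hC0 hu hu0 hg0 h1 h2 h3 hC hrρ hx hs
end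
end

section
/- Let N ≥ 1, r > 0 and c₀ ≥ 0. Let Ψ : ℝ^N → ℝ^N be differentiable on B_r(0) with ‖Ψ(z) − z‖ ≤ c₀‖z‖²/r and ‖DΨ(z) − Id‖ ≤ c₀‖z‖/r for all z ∈ B_r(0); let Φ : ℝ^N → ℝ^N be differentiable on B_{(1+c₀)r}(0) with ‖Φ(w) − w‖ ≤ c₀‖w‖²/r and ‖DΦ(w) − Id‖ ≤ c₀‖w‖/r for all w ∈ B_{(1+c₀)r}(0); and let A : ℝ^N → ℝ^N be a linear isometry. Then for every y ∈ B_r(0): ‖Φ(A(Ψ(y))) − A(y)‖ ≤ 2c₀(1+c₀)²·‖y‖²/r, and ‖DΦ(A(Ψ(y))) ∘ A ∘ DΨ(y) − A‖ ≤ 2c₀(1+c₀)²·‖y‖/r. -/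
noncomputable section

/-- Composition estimate for nonlinear reflections: if `Ψ` is a near-identity map on
`B_r(0)`, `Φ` a near-identity map on `B_{(1+c₀)r}(0)` (both with quadratic closeness
to the identity), and `A` is a linear isometry, then the composition `Φ ∘ A ∘ Ψ` is
quadratically close to `A` on `B_r(0)`, together with the corresponding derivative bound. -/
theorem stmt_8 (N : ℕ) (hN : 1 ≤ N) (r c₀ : ℝ) (hr : 0 < r) (hc₀ : 0 ≤ c₀)
    (Ψ Φ : EuclideanSpace ℝ (Fin N) → EuclideanSpace ℝ (Fin N))
    (A : EuclideanSpace ℝ (Fin N) →ₗᵢ[ℝ] EuclideanSpace ℝ (Fin N))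
    (hΨdiff : ∀ z ∈ Metric.ball (0 : EuclideanSpace ℝ (Fin N)) r, DifferentiableAt ℝ Ψ z)
    (hΨ0 : ∀ z ∈ Metric.ball (0 : EuclideanSpace ℝ (Fin N)) r,
      ‖Ψ z - z‖ ≤ c₀ * ‖z‖ ^ 2 / r)
    (hΨ1 : ∀ z ∈ Metric.ball (0 : EuclideanSpace ℝ (Fin N)) r,
      ‖fderiv ℝ Ψ z - ContinuousLinearMap.id ℝ (EuclideanSpace ℝ (Fin N))‖ ≤ c₀ * ‖z‖ / r)
    (hΦdiff : ∀ w ∈ Metric.ball (0 : EuclideanSpace ℝ (Fin N)) ((1 + c₀) * r),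
      DifferentiableAt ℝ Φ w)
    (hΦ0 : ∀ w ∈ Metric.ball (0 : EuclideanSpace ℝ (Fin N)) ((1 + c₀) * r),
      ‖Φ w - w‖ ≤ c₀ * ‖w‖ ^ 2 / r)
    (hΦ1 : ∀ w ∈ Metric.ball (0 : EuclideanSpace ℝ (Fin N)) ((1 + c₀) * r),
      ‖fderiv ℝ Φ w - ContinuousLinearMap.id ℝ (EuclideanSpace ℝ (Fin N))‖ ≤ c₀ * ‖w‖ / r)
    (y : EuclideanSpace ℝ (Fin N)) (hy : y ∈ Metric.ball (0 : EuclideanSpace ℝ (Fin N)) r) :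
    ‖Φ (A (Ψ y)) - A y‖ ≤ 2 * c₀ * (1 + c₀) ^ 2 * ‖y‖ ^ 2 / r ∧
    ‖(fderiv ℝ Φ (A (Ψ y))).comp (A.toContinuousLinearMap.comp (fderiv ℝ Ψ y))
        - A.toContinuousLinearMap‖ ≤ 2 * c₀ * (1 + c₀) ^ 2 * ‖y‖ / r := by
  have hyr : ‖y‖ < r := mem_ball_zero_iff.mp hy
  have hy0 := norm_nonneg y
  have hquot : ‖y‖ / r ≤ 1 := (div_le_one hr).mpr hyr.le
  have hΨy := hΨ0 y hy
  have hw : ‖A (Ψ y)‖ ≤ (1 + c₀) * ‖y‖ := by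
    rw [A.norm_map]
    calc ‖Ψ y‖ = ‖y + (Ψ y - y)‖ := by rw [add_sub_cancel]
      _ ≤ ‖y‖ + c₀ * ‖y‖ ^ 2 / r := (norm_add_le _ _).trans (by gcongr)
      _ = ‖y‖ + c₀ * ‖y‖ * (‖y‖ / r) := by ring
      _ ≤ ‖y‖ + c₀ * ‖y‖ * 1 := by gcongr
      _ = (1 + c₀) * ‖y‖ := by ring
  have hwball : A (Ψ y) ∈ Metric.ball (0 : EuclideanSpace ℝ (Fin N)) ((1 + c₀) * r) :=
    mem_ball_zero_iff.mpr (hw.trans_lt (by gcongr))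
  have hone : 1 ≤ (1 + c₀) ^ 2 := one_le_pow₀ (by linarith)
  constructor
  · calc ‖Φ (A (Ψ y)) - A y‖ = ‖(Φ (A (Ψ y)) - A (Ψ y)) + A (Ψ y - y)‖ := by
          rw [map_sub, sub_add_sub_cancel]
      _ ≤ ‖Φ (A (Ψ y)) - A (Ψ y)‖ + ‖Ψ y - y‖ := by
          rw [← A.norm_map (Ψ y - y)]
          exact norm_add_le _ _
      _ ≤ c₀ * ‖A (Ψ y)‖ ^ 2 / r + c₀ * ‖y‖ ^ 2 / r := add_le_add (hΦ0 _ hwball) hΨy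
      _ ≤ c₀ * ((1 + c₀) * ‖y‖) ^ 2 / r + c₀ * ‖y‖ ^ 2 / r := by gcongr
      _ = c₀ * ‖y‖ ^ 2 / r * ((1 + c₀) ^ 2 + 1) := by ring
      _ ≤ c₀ * ‖y‖ ^ 2 / r * ((1 + c₀) ^ 2 + (1 + c₀) ^ 2) := by gcongr
      _ = 2 * c₀ * (1 + c₀) ^ 2 * ‖y‖ ^ 2 / r := by ring
  · have hDΨ := hΨ1 y hy
    have hDΦ := hΦ1 _ hwball
    have hA := A.norm_toContinuousLinearMap_le
    set I := ContinuousLinearMap.id ℝ (EuclideanSpace ℝ (Fin N)) with hI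
    set P := fderiv ℝ Ψ y
    set Q := fderiv ℝ Φ (A (Ψ y))
    set L := A.toContinuousLinearMap
    have hP : ‖P‖ ≤ 1 + c₀ := by
      calc ‖P‖ = ‖I + (P - I)‖ := by rw [add_sub_cancel]
        _ ≤ 1 + c₀ * ‖y‖ / r :=
          (norm_add_le _ _).trans (add_le_add ContinuousLinearMap.norm_id_le hDΨ)
        _ = 1 + c₀ * (‖y‖ / r) := by ring
        _ ≤ 1 + c₀ * 1 := by gcongr
        _ = 1 + c₀ := by ring
    have hdecomp : Q.comp (L.comp P) - L = (Q - I).comp (L.comp P) + L.comp (P - I) := by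
      ext1 v
      simp [hI]
    calc ‖Q.comp (L.comp P) - L‖ ≤ ‖Q - I‖ * (‖L‖ * ‖P‖) + ‖L‖ * ‖P - I‖ := by
          rw [hdecomp]
          refine (norm_add_le _ _).trans (add_le_add ?_ (L.opNorm_comp_le _))
          exact ((Q - I).opNorm_comp_le _).trans (by gcongr; exact L.opNorm_comp_le _)
      _ ≤ c₀ * ((1 + c₀) * ‖y‖) / r * (1 * (1 + c₀)) + 1 * (c₀ * ‖y‖ / r) := by
          have hQ : ‖Q - I‖ ≤ c₀ * ((1 + c₀) * ‖y‖) / r := hDΦ.trans (by gcongr)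
          gcongr
      _ = c₀ * ‖y‖ / r * ((1 + c₀) ^ 2 + 1) := by ring
      _ ≤ c₀ * ‖y‖ / r * ((1 + c₀) ^ 2 + (1 + c₀) ^ 2) := by gcongr
      _ = 2 * c₀ * (1 + c₀) ^ 2 * ‖y‖ / r := by ring
end
end

section
/- Let n ≤ N be positive integers, let F : ℝ^N → ℝ^N be twice differentiable at a point x, let R : ℝ^N → ℝ^N be a linear isometry, and let ε, M ≥ 0 satisfy ‖DF(x) − R‖ ≤ ε (operator norm) and ‖D²F(x)‖ ≤ M. Then for every n-dimensional linear subspace L ⊆ ℝ^N with orthonormal basis e₁,…,eₙ, | Σ_{i=1}^n D²(‖F‖²)(x)[e_i, e_i] − 2n | ≤ 2n( 2ε + ε² + ‖F(x)‖·M ). -/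
noncomputable section

/-- The Hessian of `‖F‖²` is `2 (⟪F, D²F[v, w]⟫ + ⟪DF v, DF w⟫)`. -/
theorem iteratedFDeriv_two_norm_sq_apply {E G : Type*} [NormedAddCommGroup E] [NormedSpace ℝ E]
    [NormedAddCommGroup G] [InnerProductSpace ℝ G] {F : E → G} {x : E}
    (hF : ContDiffAt ℝ 2 F x) (v w : E) :
    iteratedFDeriv ℝ 2 (fun z => ‖F z‖ ^ 2) x ![v, w] =
      2 * (inner ℝ (F x) (iteratedFDeriv ℝ 2 F x ![v, w]) +
        inner ℝ (fderiv ℝ F x v) (fderiv ℝ F x w)) := by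
  have hF' : DifferentiableAt ℝ F x := hF.differentiableAt (by norm_num)
  have hDF : DifferentiableAt ℝ (fderiv ℝ F) x :=
    (hF.fderiv_right (m := 1) (by norm_num)).differentiableAt (by norm_num)
  have hDsq : DifferentiableAt ℝ (fderiv ℝ fun z => ‖F z‖ ^ 2) x :=
    ((hF.norm_sq ℝ).fderiv_right (m := 1) (by norm_num)).differentiableAt (by norm_num)
  have hev : (fun z => fderiv ℝ (fun z => ‖F z‖ ^ 2) z w) =ᶠ[nhds x]
      fun z => 2 * inner ℝ (F z) (fderiv ℝ F z w) := by
    filter_upwards [hF.eventually (by simp)] with z hz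
    have hz' : DifferentiableAt ℝ F z := hz.differentiableAt (by norm_num)
    rw [hz'.hasFDerivAt.norm_sq.fderiv]
    simp
  have hd := (hDsq.hasFDerivAt.clm_apply (hasFDerivAt_const w x)).congr_of_eventuallyEq hev.symm
  have hd' := (hF'.hasFDerivAt.inner ℝ
    (hDF.hasFDerivAt.clm_apply (hasFDerivAt_const w x))).const_mul (2 : ℝ)
  have h := congrArg (fun T => T v) (hd.unique hd')
  simpa [iteratedFDeriv_two_apply, fderivInnerCLM_apply] using h

/-- A vector of norm at most `ε` away from a unit vector has squared norm close to `1`. -/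
theorem abs_norm_sq_sub_one_le {G : Type*} [SeminormedAddCommGroup G] {a b : G} {ε : ℝ}
    (hb : ‖b‖ = 1) (hab : ‖a - b‖ ≤ ε) : |‖a‖ ^ 2 - 1| ≤ 2 * ε + ε ^ 2 := by
  have h := abs_le.1 ((abs_norm_sub_norm_le a b).trans hab)
  rw [hb] at h
  rw [abs_le]
  constructor <;> nlinarith [norm_nonneg a, sq_nonneg (‖a‖ - 1 + ε), sq_nonneg ε]

/-- Trace estimate for the Hessian of `‖F‖²`: if `F : ℝ^N → ℝ^N` is twice differentiable
at `x`, `‖DF(x) − R‖ ≤ ε` for a linear isometry `R`, and `‖D²F(x)‖ ≤ M`, then for every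
`n`-dimensional subspace `L` with orthonormal basis `e₁,…,eₙ`,
`|tr_L D²(‖F‖²)(x) − 2n| ≤ 2n(2ε + ε² + ‖F(x)‖M)`. -/
theorem stmt_9 (n N : ℕ) (hn : 0 < n) (hnN : n ≤ N)
    (F : EuclideanSpace ℝ (Fin N) → EuclideanSpace ℝ (Fin N))
    (x : EuclideanSpace ℝ (Fin N))
    (R : EuclideanSpace ℝ (Fin N) →ₗᵢ[ℝ] EuclideanSpace ℝ (Fin N))
    (ε M : ℝ) (hε : 0 ≤ ε) (hM : 0 ≤ M)
    (hF : ContDiffAt ℝ 2 F x)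
    (hDF : ‖fderiv ℝ F x - R.toContinuousLinearMap‖ ≤ ε)
    (hD2F : ‖iteratedFDeriv ℝ 2 F x‖ ≤ M)
    (L : Submodule ℝ (EuclideanSpace ℝ (Fin N)))
    (e : Fin n → EuclideanSpace ℝ (Fin N))
    (he : Orthonormal ℝ e) (heL : Submodule.span ℝ (Set.range e) = L) :
    |∑ i : Fin n, (iteratedFDeriv ℝ 2 (fun z => ‖F z‖ ^ 2) x) ![e i, e i] - 2 * n|
      ≤ 2 * n * (2 * ε + ε ^ 2 + ‖F x‖ * M) := by
  have key (i : Fin n) :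
      |iteratedFDeriv ℝ 2 (fun z => ‖F z‖ ^ 2) x ![e i, e i] - 2| ≤
        2 * (2 * ε + ε ^ 2 + ‖F x‖ * M) := by
    have hei : ‖e i‖ = 1 := he.1 i
    have hfirst : |‖fderiv ℝ F x (e i)‖ ^ 2 - 1| ≤ 2 * ε + ε ^ 2 := by
      refine abs_norm_sq_sub_one_le (b := R (e i)) (by rw [R.norm_map, hei]) ?_
      simpa [hei] using (fderiv ℝ F x - R.toContinuousLinearMap).le_of_opNorm_le hDF (e i)
    have hsecond : |inner ℝ (F x) (iteratedFDeriv ℝ 2 F x ![e i, e i])| ≤ ‖F x‖ * M := by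
      refine (abs_real_inner_le_norm _ _).trans ?_
      gcongr
      simpa [Fin.prod_univ_two, hei] using
        (iteratedFDeriv ℝ 2 F x).le_of_opNorm_le hD2F ![e i, e i]
    rw [iteratedFDeriv_two_norm_sq_apply hF, real_inner_self_eq_norm_sq]
    rw [abs_le] at hfirst hsecond ⊢
    constructor <;> linarith
  calc
    _ = |∑ i : Fin n, (iteratedFDeriv ℝ 2 (fun z => ‖F z‖ ^ 2) x ![e i, e i] - 2)| := by
      simp [Finset.sum_sub_distrib, mul_comm]
    _ ≤ ∑ _i : Fin n, 2 * (2 * ε + ε ^ 2 + ‖F x‖ * M) :=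
      (Finset.abs_sum_le_sum_abs _ _).trans (Finset.sum_le_sum fun i _ => key i)
    _ = _ := by
      simp only [Finset.sum_const, Finset.card_univ, Fintype.card_fin, nsmul_eq_mul]
      ring
end
end

section
/- Let n < N be positive integers. There exist ε₁ > 0 and c > 0, depending only on n and N, with the following property. Let r > 0 and let u : ℝ^n × ℝ → ℝ^{N−n} be continuously differentiable on the parabolic ball B^{n,1}_r = {(x,t) : ‖x‖ < r, |t| < r²} with r^{−1}‖u(x,t)‖ + ‖D_x u(x,t)‖ + r‖∂_t u(x,t)‖ ≤ 1 on B^{n,1}_r. Let 0 ≤ ε ≤ ε₁ and let e : ℝ^N → ℝ^N be continuously differentiable on B_{3r}(0) ⊆ ℝ^N with r^{−1}‖e(z)‖ + ‖De(z)‖ ≤ ε there, and set φ = Id + e. Identify ℝ^N = ℝ^n × ℝ^{N−n}. Then there exist maps ξ : ℝ^n × ℝ → ℝ^n and η : ℝ^n × ℝ → ℝ^{N−n}, continuously differentiable on B^{n,1}_{r/2}, satisfying r^{−1}‖ξ‖ + ‖D_xξ‖ + r‖∂_tξ‖ ≤ cε and r^{−1}‖η‖ + ‖D_xη‖ + r‖∂_tη‖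 ≤ cε pointwise on B^{n,1}_{r/2}, such that for every (y,t) ∈ B^{n,1}_{r/2} the point (y + ξ(y,t), t) lies in B^{n,1}_r and φ( y + ξ(y,t), u(y + ξ(y,t), t) ) = ( y, u(y + ξ(y,t), t) + η(y,t) ). -/
noncomputable section

open Set Filter Topology

/-- The parabolic ball `{(x, t) : ‖x‖ < r, |t| < r²}`. -/
def parabolicBall (E : Type*) [NormedAddCommGroup E] (r : ℝ) : Set (E × ℝ) :=
  {p | ‖p.1‖ < r ∧ |p.2| < r ^ 2}

theorem isOpen_parabolicBall {E : Type*} [NormedAddCommGroup E] (r : ℝ) :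
    IsOpen (parabolicBall E r) :=
  (isOpen_lt continuous_fst.norm continuous_const).inter
    (isOpen_lt continuous_snd.abs continuous_const)

theorem WithLp.norm_toLp_two_le {E F : Type*} [NormedAddCommGroup E]
    [NormedAddCommGroup F] (x : E) (y : F) : ‖WithLp.toLp 2 (x, y)‖ ≤ ‖x‖ + ‖y‖ := by
  refine le_of_sq_le_sq ?_ (by positivity)
  rw [WithLp.prod_norm_sq_eq_of_L2]
  change ‖x‖ ^ 2 + ‖y‖ ^ 2 ≤ _
  nlinarith [norm_nonneg x, norm_nonneg y]

variable {E F G : Type*} [NormedAddCommGroup E] [NormedSpace ℝ E]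
  [NormedAddCommGroup F] [NormedSpace ℝ F] [NormedAddCommGroup G] [NormedSpace ℝ G]

theorem HasFDerivAt.space_slice {f : E × ℝ → F} {f' : E × ℝ →L[ℝ] F} {x : E} {t : ℝ}
    (hf : HasFDerivAt f f' (x, t)) :
    HasFDerivAt (fun y => f (y, t)) (f'.comp (.inl ℝ E ℝ)) x :=
  HasFDerivAt.comp x hf (hasFDerivAt_prodMk_left x t)

theorem HasFDerivAt.time_slice {f : E × ℝ → F} {f' : E × ℝ →L[ℝ] F} {x : E} {t : ℝ}
    (hf : HasFDerivAt f f' (x, t)) : HasDerivAt (fun s => f (x, s)) (f' (0, 1)) t := by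
  simpa [Function.comp_def] using
    (HasFDerivAt.comp t hf (hasFDerivAt_prodMk_right x t)).hasDerivAt

/-- A bound `a` on the spatial derivative of `f` at `p` and a bound `b` on its time derivative. -/
def SlicewiseDerivBound (f : E × ℝ → F) (a b : ℝ) (p : E × ℝ) : Prop :=
  (∀ v, ‖fderiv ℝ f p (v, 0)‖ ≤ a * ‖v‖) ∧ ‖fderiv ℝ f p (0, 1)‖ ≤ b

theorem SlicewiseDerivBound.norm_fderiv_slice_le {f : E × ℝ → F} {a b : ℝ} {x : E} {t : ℝ}
    (h : SlicewiseDerivBound f a b (x, t)) (hf : DifferentiableAt ℝ f (x, t)) (ha : 0 ≤ a) :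
    ‖fderiv ℝ (fun y => f (y, t)) x‖ ≤ a := by
  rw [hf.hasFDerivAt.space_slice.fderiv]
  exact ContinuousLinearMap.opNorm_le_bound _ ha h.1

theorem SlicewiseDerivBound.norm_deriv_slice_le {f : E × ℝ → F} {a b : ℝ} {x : E} {t : ℝ}
    (h : SlicewiseDerivBound f a b (x, t)) (hf : DifferentiableAt ℝ f (x, t)) :
    ‖deriv (fun s => f (x, s)) t‖ ≤ b := by
  rw [hf.hasFDerivAt.time_slice.deriv]
  exact h.2

theorem slicewiseDerivBound_of_slices {f : E × ℝ → F} {x : E} {t : ℝ}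
    (hf : DifferentiableAt ℝ f (x, t)) :
    SlicewiseDerivBound f ‖fderiv ℝ (fun y => f (y, t)) x‖ ‖deriv (fun s => f (x, s)) t‖
      (x, t) := by
  rw [hf.hasFDerivAt.space_slice.fderiv, hf.hasFDerivAt.time_slice.deriv]
  exact ⟨fun v => ((fderiv ℝ f (x, t)).comp (.inl ℝ E ℝ)).le_opNorm v, le_rfl⟩

/-- Chain rule for `(y, t) ↦ h (y + ξ (y, t), t)`. -/
theorem HasFDerivAt.comp_spatial_shift {h : E × ℝ → F} {h' : E × ℝ →L[ℝ] F} {ξ : E × ℝ → E}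
    {ξ' : E × ℝ →L[ℝ] E} {q : E × ℝ} (hh : HasFDerivAt h h' (q.1 + ξ q, q.2))
    (hξ : HasFDerivAt ξ ξ' q) :
    HasFDerivAt (fun q => h (q.1 + ξ q, q.2))
      (h'.comp ((.fst ℝ E ℝ + ξ').prod (.snd ℝ E ℝ))) q :=
  HasFDerivAt.comp q hh ((hasFDerivAt_fst.add hξ).prodMk hasFDerivAt_snd)

theorem SlicewiseDerivBound.comp_spatial_shift {h : E × ℝ → F} {ξ : E × ℝ → E} {q : E × ℝ}
    {a b α β : ℝ} (ha : 0 ≤ a) (hh : DifferentiableAt ℝ h (q.1 + ξ q, q.2))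
    (hξ : DifferentiableAt ℝ ξ q) (bh : SlicewiseDerivBound h a b (q.1 + ξ q, q.2))
    (bξ : SlicewiseDerivBound ξ α β q) :
    SlicewiseDerivBound (fun q => h (q.1 + ξ q, q.2)) (a * (1 + α)) (a * β + b) q := by
  have hd := (hh.hasFDerivAt.comp_spatial_shift hξ.hasFDerivAt).fderiv
  refine ⟨fun v => ?_, ?_⟩
  · rw [hd]
    calc ‖fderiv ℝ h (q.1 + ξ q, q.2) (v + fderiv ℝ ξ q (v, 0), 0)‖
        ≤ a * ‖v + fderiv ℝ ξ q (v, 0)‖ := bh.1 _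
      _ ≤ a * (‖v‖ + α * ‖v‖) := by
          gcongr
          exact (norm_add_le _ _).trans (by gcongr; exact bξ.1 v)
      _ = a * (1 + α) * ‖v‖ := by ring
  · rw [hd]
    have hsplit : (((0 : E) + fderiv ℝ ξ q (0, 1), (1 : ℝ)) : E × ℝ)
        = (fderiv ℝ ξ q (0, 1), 0) + (0, 1) := by simp
    calc ‖fderiv ℝ h (q.1 + ξ q, q.2) ((0 : E) + fderiv ℝ ξ q (0, 1), 1)‖
        ≤ ‖fderiv ℝ h (q.1 + ξ q, q.2) (fderiv ℝ ξ q (0, 1), 0)‖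
            + ‖fderiv ℝ h (q.1 + ξ q, q.2) (0, 1)‖ := by
          rw [hsplit, map_add]; exact norm_add_le _ _
      _ ≤ a * β + b := by
          gcongr
          · exact (bh.1 _).trans (by gcongr; exact bξ.2)
          · exact bh.2

/-- If `ξ (y, t) = -g (y + ξ (y, t), t)` with `g` slowly varying in space, then the derivative
bounds of `g` pass to `ξ`. -/
theorem SlicewiseDerivBound.of_implicit {g : E × ℝ → E} {ξ : E × ℝ → E} {q : E × ℝ}
    {a b : ℝ} (ha : 0 ≤ a) (ha' : a ≤ 1 / 4) (hg : DifferentiableAt ℝ g (q.1 + ξ q, q.2))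
    (hξ : DifferentiableAt ℝ ξ q) (bg : SlicewiseDerivBound g a b (q.1 + ξ q, q.2))
    (heq : ξ =ᶠ[𝓝 q] fun q => -g (q.1 + ξ q, q.2)) :
    SlicewiseDerivBound ξ (4 / 3 * a) (4 / 3 * b) q := by
  have hd := ((hg.hasFDerivAt.comp_spatial_shift hξ.hasFDerivAt).fun_neg.congr_of_eventuallyEq
    heq).fderiv
  set A := fderiv ℝ g (q.1 + ξ q, q.2)
  refine ⟨fun v => ?_, ?_⟩
  · have h1 : ‖fderiv ℝ ξ q (v, 0)‖ ≤ a * (‖v‖ + ‖fderiv ℝ ξ q (v, 0)‖) :=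
      calc ‖fderiv ℝ ξ q (v, 0)‖ = ‖-A (v + fderiv ℝ ξ q (v, 0), 0)‖ := by
            conv_lhs => rw [hd]
            rfl
        _ ≤ a * ‖v + fderiv ℝ ξ q (v, 0)‖ := by rw [norm_neg]; exact bg.1 _
        _ ≤ _ := by gcongr; exact norm_add_le _ _
    nlinarith [norm_nonneg (fderiv ℝ ξ q (v, 0))]
  · have hsplit : (((0 : E) + fderiv ℝ ξ q (0, 1), (1 : ℝ)) : E × ℝ)
        = (fderiv ℝ ξ q (0, 1), 0) + (0, 1) := by simp
    have h1 : ‖fderiv ℝ ξ q (0, 1)‖ ≤ a * ‖fderiv ℝ ξ q (0, 1)‖ + b :=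
      calc ‖fderiv ℝ ξ q (0, 1)‖ = ‖-A ((0 : E) + fderiv ℝ ξ q (0, 1), 1)‖ := by
            conv_lhs => rw [hd]
            rfl
        _ ≤ ‖A (fderiv ℝ ξ q (0, 1), 0)‖ + ‖A (0, 1)‖ := by
            rw [norm_neg, hsplit, map_add]; exact norm_add_le _ _
        _ ≤ _ := add_le_add (bg.1 _) bg.2
    nlinarith [norm_nonneg (fderiv ℝ ξ q (0, 1))]

/-- A map with small spatial derivative is Lipschitz on the time slices of a parabolic ball. -/
theorem norm_sub_le_of_slicewiseDerivBound {g : E × ℝ → F} {r a b : ℝ} (ha : 0 ≤ a)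
    (hg : ∀ p ∈ parabolicBall E r, DifferentiableAt ℝ g p)
    (bg : ∀ p ∈ parabolicBall E r, SlicewiseDerivBound g a b p) {x y : E} {t : ℝ}
    (hx : (x, t) ∈ parabolicBall E r) (hy : (y, t) ∈ parabolicBall E r) :
    ‖g (x, t) - g (y, t)‖ ≤ a * ‖x - y‖ := by
  have mem : ∀ z ∈ Metric.ball (0 : E) r, (z, t) ∈ parabolicBall E r :=
    fun z hz => ⟨mem_ball_zero_iff.1 hz, hx.2⟩
  exact (convex_ball (0 : E) r).norm_image_sub_le_of_norm_fderiv_le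
    (f := fun z => g (z, t))
    (fun z hz => (hg _ (mem z hz)).hasFDerivAt.space_slice.differentiableAt)
    (fun z hz => (bg _ (mem z hz)).norm_fderiv_slice_le (hg _ (mem z hz)) ha)
    (mem_ball_zero_iff.2 hy.1) (mem_ball_zero_iff.2 hx.1)

/-- Solvability of `y + ξ + g (y + ξ, t) = y` by contraction. -/
theorem exists_spatial_shift [CompleteSpace E] {g : E × ℝ → E} {r a b : ℝ} (hr : 0 < r)
    (ha : 0 ≤ a) (ha' : a ≤ 1 / 4)
    (hg : ∀ p ∈ parabolicBall E r, DifferentiableAt ℝ g p)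
    (bg : ∀ p ∈ parabolicBall E r, SlicewiseDerivBound g a b p)
    (g_le : ∀ p ∈ parabolicBall E r, ‖g p‖ ≤ r / 4) {q : E × ℝ}
    (hq : q ∈ parabolicBall E (r / 2)) :
    ∃ v, (q.1 + v, q.2) ∈ parabolicBall E r ∧ v = -g (q.1 + v, q.2) := by
  have ht : |q.2| < r ^ 2 := hq.2.trans_le (by gcongr; linarith)
  have mem : ∀ v ∈ Metric.closedBall (0 : E) (r / 4), (q.1 + v, q.2) ∈ parabolicBall E r := by
    intro v hv
    refine ⟨(norm_add_le _ _).trans_lt ?_, ht⟩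
    have := mem_closedBall_zero_iff.1 hv
    have := hq.1
    linarith
  have hmaps : MapsTo (fun v => -g (q.1 + v, q.2)) (Metric.closedBall 0 (r / 4))
      (Metric.closedBall 0 (r / 4)) := fun v hv =>
    mem_closedBall_zero_iff.2 ((norm_neg _).trans_le (g_le _ (mem v hv)))
  have hcontr : ContractingWith (1 / 4) (hmaps.restrict _ _ _) := by
    refine ⟨by rw [← NNReal.coe_lt_coe]; norm_num, LipschitzWith.of_dist_le_mul fun v w => ?_⟩
    have h := norm_sub_le_of_slicewiseDerivBound ha hg bg (mem w w.2) (mem v v.2)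
    rw [Subtype.dist_eq, Subtype.dist_eq, dist_eq_norm, dist_eq_norm]
    calc ‖-g (q.1 + v, q.2) - -g (q.1 + w, q.2)‖
        = ‖g (q.1 + w, q.2) - g (q.1 + v, q.2)‖ := by congr 1; abel
      _ ≤ a * ‖(q.1 + w) - (q.1 + v)‖ := h
      _ ≤ 1 / 4 * ‖(q.1 + w) - (q.1 + v)‖ := by gcongr
      _ = _ := by rw [add_sub_add_left_eq_sub, norm_sub_rev]; norm_num
  obtain ⟨v, hv, hfix, -⟩ := hcontr.exists_fixedPoint' Metric.isClosed_closedBall.isComplete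
    hmaps (Metric.mem_closedBall_self (by positivity)) (edist_ne_top _ _)
  exact ⟨v, mem v hv, hfix.symm⟩

/-- Any solution of `ξ q = -g (q.1 + ξ q, q.2)` is as smooth as `g`, by the inverse function
theorem applied to `(x, t) ↦ (x + g (x, t), t)`. -/
theorem contDiffAt_spatial_shift [FiniteDimensional ℝ E] {g ξ : E × ℝ → E} {r ρ a b : ℝ}
    (ha : 0 ≤ a) (ha' : a ≤ 1 / 4)
    (hg : ContDiffOn ℝ 1 g (parabolicBall E r))
    (bg : ∀ p ∈ parabolicBall E r, SlicewiseDerivBound g a b p)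
    (mem : ∀ q ∈ parabolicBall E ρ, (q.1 + ξ q, q.2) ∈ parabolicBall E r)
    (heq : ∀ q ∈ parabolicBall E ρ, ξ q = -g (q.1 + ξ q, q.2))
    {q : E × ℝ} (hq : q ∈ parabolicBall E ρ) : ContDiffAt ℝ 1 ξ q := by
  have := FiniteDimensional.complete ℝ E
  have hgd : ∀ p ∈ parabolicBall E r, DifferentiableAt ℝ g p := fun p hp =>
    (hg.contDiffAt ((isOpen_parabolicBall r).mem_nhds hp)).differentiableAt one_ne_zero
  set p : E × ℝ := (q.1 + ξ q, q.2) with hp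
  have hpr : p ∈ parabolicBall E r := mem q hq
  let Φ : E × ℝ → E × ℝ := fun p => (p.1 + g p, p.2)
  have hΦ_right : ∀ q ∈ parabolicBall E ρ, Φ (q.1 + ξ q, q.2) = q := by
    intro q hq
    refine Prod.ext ?_ rfl
    have := heq q hq
    simp only [Φ]
    rw [add_assoc, add_eq_left, ← eq_neg_iff_add_eq_zero]
    exact this
  have hΦ : ContDiffAt ℝ 1 Φ p :=
    (contDiffAt_fst.add (hg.contDiffAt ((isOpen_parabolicBall r).mem_nhds hpr))).prodMk
      contDiffAt_snd
  let L : E × ℝ →L[ℝ] E × ℝ := (ContinuousLinearMap.fst ℝ E ℝ + fderiv ℝ g p).prod (.snd ℝ E ℝ)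
  have hL : HasFDerivAt Φ L p :=
    (hasFDerivAt_fst.add (hgd p hpr).hasFDerivAt).prodMk hasFDerivAt_snd
  have hinj : Function.Injective (L : E × ℝ →ₗ[ℝ] E × ℝ) := by
    rw [injective_iff_map_eq_zero]
    rintro ⟨v, s⟩ hvs
    have hs : s = 0 := congrArg Prod.snd hvs
    subst hs
    have hv : v + fderiv ℝ g p (v, 0) = 0 := congrArg Prod.fst hvs
    have h1 : ‖v‖ ≤ a * ‖v‖ := by
      conv_lhs => rw [eq_neg_of_add_eq_zero_left hv, norm_neg]
      exact (bg p hpr).1 v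
    have : ‖v‖ = 0 := by nlinarith [norm_nonneg v]
    simp [norm_eq_zero.1 this]
  let L' : (E × ℝ) ≃L[ℝ] E × ℝ :=
    (LinearEquiv.ofInjectiveEndo (L : E × ℝ →ₗ[ℝ] E × ℝ) hinj).toContinuousLinearEquiv
  have hL' : HasFDerivAt Φ (L' : E × ℝ →L[ℝ] E × ℝ) p := hL
  have hstrict := hΦ.hasStrictFDerivAt' hL' one_ne_zero
  have hΨ : ContDiffAt ℝ 1 (hstrict.localInverse Φ L' p) q := by
    have := hΦ.to_localInverse hL' one_ne_zero
    rwa [hΦ_right q hq] at this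
  have htend : Tendsto (hstrict.localInverse Φ L' p) (𝓝 q) (𝓝 p) := by
    simpa only [hp, hΦ_right q hq] using hstrict.localInverse_tendsto
  have hright : ∀ᶠ z in 𝓝 q, Φ (hstrict.localInverse Φ L' p z) = z := by
    simpa only [hp, hΦ_right q hq] using hstrict.eventually_right_inverse
  refine (hΨ.fst.sub contDiffAt_fst).congr_of_eventuallyEq ?_
  filter_upwards [hright, htend.eventually ((isOpen_parabolicBall r).mem_nhds hpr),
    (isOpen_parabolicBall ρ).mem_nhds hq] with z hz hzr hzρ
  replace hzr : hstrict.localInverse Φ L' p z ∈ parabolicBall E r := hzr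
  generalize hstrict.localInverse Φ L' p z = w at hz hzr ⊢
  obtain ⟨x, s⟩ := w
  have hs : s = z.2 := congrArg Prod.snd hz
  subst hs
  have hx : x + g (x, z.2) = z.1 := congrArg Prod.fst hz
  have hξ : z.1 + ξ z + g (z.1 + ξ z, z.2) = z.1 := congrArg Prod.fst (hΦ_right z hzρ)
  have hlip := norm_sub_le_of_slicewiseDerivBound ha hgd bg (mem z hzρ) hzr
  have hdiff : g (z.1 + ξ z, z.2) - g (x, z.2) = -(z.1 + ξ z - x) := by
    rw [eq_sub_of_add_eq' hξ, eq_sub_of_add_eq' hx]; abel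
  rw [hdiff, norm_neg] at hlip
  have : ‖z.1 + ξ z - x‖ = 0 := by nlinarith [norm_nonneg (z.1 + ξ z - x)]
  simp [← sub_eq_zero.1 (norm_eq_zero.1 this)]

/-- The derivative bounds of `e` composed with the graph map of `u`. -/
theorem SlicewiseDerivBound.comp_graph {e : WithLp 2 (E × F) → G} {u : E × ℝ → F} {p : E × ℝ}
    {δ a b : ℝ} (hδ : ‖fderiv ℝ e (WithLp.toLp 2 (p.1, u p))‖ ≤ δ)
    (he : DifferentiableAt ℝ e (WithLp.toLp 2 (p.1, u p))) (hu : DifferentiableAt ℝ u p)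
    (bu : SlicewiseDerivBound u a b p) :
    SlicewiseDerivBound (fun p => e (WithLp.toLp 2 (p.1, u p))) (δ * (1 + a)) (δ * b) p := by
  have hδ0 : 0 ≤ δ := (norm_nonneg _).trans hδ
  have hgraph : HasFDerivAt (fun p : E × ℝ => WithLp.toLp 2 (p.1, u p))
      (((WithLp.prodContinuousLinearEquiv 2 ℝ E F).symm : E × F →L[ℝ] WithLp 2 (E × F)).comp
        ((ContinuousLinearMap.fst ℝ E ℝ).prod (fderiv ℝ u p))) p :=
    ((WithLp.prodContinuousLinearEquiv 2 ℝ E F).symm :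
      E × F →L[ℝ] WithLp 2 (E × F)).hasFDerivAt.comp p (hasFDerivAt_fst.prodMk hu.hasFDerivAt)
  have hd := (HasFDerivAt.comp p he.hasFDerivAt hgraph).fderiv
  have key : ∀ w : E × ℝ, ‖fderiv ℝ (fun p => e (WithLp.toLp 2 (p.1, u p))) p w‖
      ≤ δ * (‖w.1‖ + ‖fderiv ℝ u p w‖) := by
    intro w
    calc ‖fderiv ℝ (fun p => e (WithLp.toLp 2 (p.1, u p))) p w‖
        = ‖fderiv ℝ e (WithLp.toLp 2 (p.1, u p)) (WithLp.toLp 2 (w.1, fderiv ℝ u p w))‖ :=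
          congrArg (fun A : E × ℝ →L[ℝ] G => ‖A w‖) hd
      _ ≤ δ * ‖WithLp.toLp 2 (w.1, fderiv ℝ u p w)‖ :=
          ContinuousLinearMap.le_of_opNorm_le _ hδ _
      _ ≤ _ := by gcongr; exact WithLp.norm_toLp_two_le _ _
  refine ⟨fun v => (key _).trans ?_, (key _).trans ?_⟩
  · calc δ * (‖v‖ + ‖fderiv ℝ u p (v, 0)‖) ≤ δ * (‖v‖ + a * ‖v‖) := by gcongr; exact bu.1 v
      _ = _ := by ring
  · simpa using mul_le_mul_of_nonneg_left bu.2 hδ0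

/-- Post-composition with a norm-nonincreasing linear map preserves derivative bounds. -/
theorem SlicewiseDerivBound.clm_comp {f : E × ℝ → F} {a b : ℝ} {p : E × ℝ} (A : F →L[ℝ] G)
    (hA : ∀ x, ‖A x‖ ≤ ‖x‖) (hf : DifferentiableAt ℝ f p) (bf : SlicewiseDerivBound f a b p) :
    SlicewiseDerivBound (fun p => A (f p)) a b p := by
  have hd := (A.hasFDerivAt.comp p hf.hasFDerivAt).fderiv
  have key : ∀ w, ‖fderiv ℝ (fun p => A (f p)) p w‖ ≤ ‖fderiv ℝ f p w‖ := fun w =>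
    (congrArg (fun B : E × ℝ →L[ℝ] G => ‖B w‖) hd).trans_le (hA _)
  exact ⟨fun v => (key _).trans (bf.1 v), (key _).trans bf.2⟩

/-- Graph perturbation lemma (C¹ part): there are `ε₁(n,N) > 0`, `c(n,N) > 0` such that if
`u` is a C¹ spacetime graph function on the parabolic ball `B^{n,1}_r` with scale-invariant
C¹ bound 1, and `φ = Id + e` is a near-identity C¹ map of `ℝ^N = ℝ^n × ℝ^{N−n}` (Euclidean
`ℓ²` identification) with `r⁻¹‖e‖ + ‖De‖ ≤ ε ≤ ε₁` on `B_{3r}(0)`, then the image of the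
spacetime graph of `u` under `φ` is again a spacetime graph: there are `ξ, η`, C¹ on
`B^{n,1}_{r/2}` with scale-invariant C¹ bounds `≤ cε`, such that
`φ(y + ξ(y,t), u(y + ξ(y,t), t)) = (y, u(y + ξ(y,t), t) + η(y,t))`. -/
theorem stmt_12 (n N : ℕ) (hn : 0 < n) (hnN : n < N) :
    ∃ ε₁ : ℝ, 0 < ε₁ ∧ ∃ c : ℝ, 0 < c ∧
      ∀ r : ℝ, 0 < r →
      ∀ u : EuclideanSpace ℝ (Fin n) × ℝ → EuclideanSpace ℝ (Fin (N - n)),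
        ContDiffOn ℝ 1 u {p : EuclideanSpace ℝ (Fin n) × ℝ | ‖p.1‖ < r ∧ |p.2| < r ^ 2} →
        (∀ (x : EuclideanSpace ℝ (Fin n)) (t : ℝ), ‖x‖ < r → |t| < r ^ 2 →
          r⁻¹ * ‖u (x, t)‖ + ‖fderiv ℝ (fun y => u (y, t)) x‖
            + r * ‖deriv (fun s => u (x, s)) t‖ ≤ 1) →
      ∀ ε : ℝ, 0 ≤ ε → ε ≤ ε₁ →
      ∀ e : WithLp 2 (EuclideanSpace ℝ (Fin n) × EuclideanSpace ℝ (Fin (N - n)))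
          → WithLp 2 (EuclideanSpace ℝ (Fin n) × EuclideanSpace ℝ (Fin (N - n))),
        ContDiffOn ℝ 1 e (Metric.ball 0 (3 * r)) →
        (∀ z ∈ Metric.ball
            (0 : WithLp 2 (EuclideanSpace ℝ (Fin n) × EuclideanSpace ℝ (Fin (N - n))))
            (3 * r),
          r⁻¹ * ‖e z‖ + ‖fderiv ℝ e z‖ ≤ ε) →
      ∃ ξ : EuclideanSpace ℝ (Fin n) × ℝ → EuclideanSpace ℝ (Fin n),
      ∃ η : EuclideanSpace ℝ (Fin n) × ℝ → EuclideanSpace ℝ (Fin (N - n)),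
        ContDiffOn ℝ 1 ξ
          {p : EuclideanSpace ℝ (Fin n) × ℝ | ‖p.1‖ < r / 2 ∧ |p.2| < (r / 2) ^ 2} ∧
        ContDiffOn ℝ 1 η
          {p : EuclideanSpace ℝ (Fin n) × ℝ | ‖p.1‖ < r / 2 ∧ |p.2| < (r / 2) ^ 2} ∧
        ∀ (y : EuclideanSpace ℝ (Fin n)) (t : ℝ), ‖y‖ < r / 2 → |t| < (r / 2) ^ 2 →
          (r⁻¹ * ‖ξ (y, t)‖ + ‖fderiv ℝ (fun z => ξ (z, t)) y‖
              + r * ‖deriv (fun s => ξ (y, s)) t‖ ≤ c * ε) ∧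
          (r⁻¹ * ‖η (y, t)‖ + ‖fderiv ℝ (fun z => η (z, t)) y‖
              + r * ‖deriv (fun s => η (y, s)) t‖ ≤ c * ε) ∧
          ‖y + ξ (y, t)‖ < r ∧ |t| < r ^ 2 ∧
          ((WithLp.equiv 2 (EuclideanSpace ℝ (Fin n) × EuclideanSpace ℝ (Fin (N - n)))).symm
              (y + ξ (y, t), u (y + ξ (y, t), t))
            + e ((WithLp.equiv 2
                (EuclideanSpace ℝ (Fin n) × EuclideanSpace ℝ (Fin (N - n)))).symm
                  (y + ξ (y, t), u (y + ξ (y, t), t)))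
            = (WithLp.equiv 2
                (EuclideanSpace ℝ (Fin n) × EuclideanSpace ℝ (Fin (N - n)))).symm
                  (y, u (y + ξ (y, t), t) + η (y, t))) := by
  refine ⟨1 / 8, by norm_num, 10, by norm_num, ?_⟩
  intro r hr u hu bu ε hε hε₁ e he be
  change ContDiffOn ℝ 1 u (parabolicBall _ r) at hu
  have hud : ∀ p ∈ parabolicBall _ r, DifferentiableAt ℝ u p := fun p hp =>
    (hu.contDiffAt ((isOpen_parabolicBall r).mem_nhds hp)).differentiableAt one_ne_zero
  have u_le : ∀ p ∈ parabolicBall _ r, ‖u p‖ ≤ r := by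
    intro p hp
    have h := bu p.1 p.2 hp.1 hp.2
    have h1 : r⁻¹ * ‖u p‖ ≤ 1 := by
      have := norm_nonneg (fderiv ℝ (fun y => u (y, p.2)) p.1)
      have : 0 ≤ r * ‖deriv (fun s => u (p.1, s)) p.2‖ := by positivity
      linarith
    rwa [inv_mul_le_iff₀ hr, mul_one] at h1
  have graph_mem : ∀ p ∈ parabolicBall _ r,
      WithLp.toLp 2 (p.1, u p) ∈ Metric.ball (0 : WithLp 2
        (EuclideanSpace ℝ (Fin n) × EuclideanSpace ℝ (Fin (N - n)))) (3 * r) := by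
    intro p hp
    refine mem_ball_zero_iff.2 ((WithLp.norm_toLp_two_le _ _).trans_lt ?_)
    have := u_le p hp
    have := hp.1
    linarith
  let k : EuclideanSpace ℝ (Fin n) × ℝ → WithLp 2
      (EuclideanSpace ℝ (Fin n) × EuclideanSpace ℝ (Fin (N - n))) :=
    fun p => e (WithLp.toLp 2 (p.1, u p))
  have hk : ContDiffOn ℝ 1 k (parabolicBall _ r) :=
    he.comp ((WithLp.prodContinuousLinearEquiv 2 ℝ _ _).symm.contDiff.comp_contDiffOn
      (contDiffOn_fst.prodMk hu)) graph_mem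
  have hkd : ∀ p ∈ parabolicBall _ r, DifferentiableAt ℝ k p := fun p hp =>
    (hk.contDiffAt ((isOpen_parabolicBall r).mem_nhds hp)).differentiableAt one_ne_zero
  have k_le : ∀ p ∈ parabolicBall _ r, ‖k p‖ ≤ r * ε := by
    intro p hp
    rw [← inv_mul_le_iff₀ hr]
    exact (le_add_of_nonneg_right (norm_nonneg _)).trans (be _ (graph_mem p hp))
  have bk : ∀ p ∈ parabolicBall _ r, SlicewiseDerivBound k (2 * ε) (ε / r) p := by
    intro p hp
    have hz := graph_mem p hp
    have hδ : ‖fderiv ℝ e (WithLp.toLp 2 (p.1, u p))‖ ≤ ε :=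
      (le_add_of_nonneg_left (by positivity)).trans (be _ hz)
    have h := SlicewiseDerivBound.comp_graph hδ ((he.contDiffAt (Metric.isOpen_ball.mem_nhds
      hz)).differentiableAt one_ne_zero) (hud p hp) (slicewiseDerivBound_of_slices (hud p hp))
    have hb := bu p.1 p.2 hp.1 hp.2
    have h0 : 0 ≤ r⁻¹ * ‖u p‖ := by positivity
    have h1 := norm_nonneg (fderiv ℝ (fun y => u (y, p.2)) p.1)
    have h2 : 0 ≤ r * ‖deriv (fun s => u (p.1, s)) p.2‖ := by positivity
    have hx : ‖fderiv ℝ (fun y => u (y, p.2)) p.1‖ ≤ 1 := by linarith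
    have ht : ‖deriv (fun s => u (p.1, s)) p.2‖ ≤ 1 / r := by
      rw [le_div_iff₀' hr]; linarith
    refine ⟨fun v => (h.1 v).trans ?_, h.2.trans ?_⟩
    · refine mul_le_mul_of_nonneg_right ?_ (norm_nonneg v)
      nlinarith
    · calc _ ≤ ε * (1 / r) := by gcongr
        _ = ε / r := by ring
  let g := fun p => WithLp.fstL 2 ℝ _ _ (k p)
  let h := fun p => WithLp.sndL 2 ℝ _ _ (k p)
  have hg : ContDiffOn ℝ 1 g (parabolicBall _ r) := hk.continuousLinearMap_comp _
  have hh : ContDiffOn ℝ 1 h (parabolicBall _ r) := hk.continuousLinearMap_comp _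
  have hgd : ∀ p ∈ parabolicBall _ r, DifferentiableAt ℝ g p := fun p hp =>
    (hg.contDiffAt ((isOpen_parabolicBall r).mem_nhds hp)).differentiableAt one_ne_zero
  have hhd : ∀ p ∈ parabolicBall _ r, DifferentiableAt ℝ h p := fun p hp =>
    (hh.contDiffAt ((isOpen_parabolicBall r).mem_nhds hp)).differentiableAt one_ne_zero
  have bg : ∀ p ∈ parabolicBall _ r, SlicewiseDerivBound g (2 * ε) (ε / r) p := fun p hp =>
    (bk p hp).clm_comp _ (WithLp.norm_fst_le _) (hkd p hp)
  have bh : ∀ p ∈ parabolicBall _ r, SlicewiseDerivBound h (2 * ε) (ε / r) p := fun p hp =>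
    (bk p hp).clm_comp _ (WithLp.norm_snd_le _) (hkd p hp)
  have g_le : ∀ p ∈ parabolicBall _ r, ‖g p‖ ≤ r * ε := fun p hp =>
    (WithLp.norm_fst_le _ _).trans (k_le p hp)
  have h_le : ∀ p ∈ parabolicBall _ r, ‖h p‖ ≤ r * ε := fun p hp =>
    (WithLp.norm_snd_le _ _).trans (k_le p hp)
  have hε0 : 0 ≤ 2 * ε := by positivity
  have hε4 : 2 * ε ≤ 1 / 4 := by linarith
  have hsol : ∀ q ∈ parabolicBall (EuclideanSpace ℝ (Fin n)) (r / 2), ∃ v,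
      (q.1 + v, q.2) ∈ parabolicBall _ r ∧ v = -g (q.1 + v, q.2) := fun q hq =>
    exists_spatial_shift hr hε0 hε4 hgd bg (fun p hp => (g_le p hp).trans (by nlinarith)) hq
  choose! ξ mem heq using hsol
  have hξ : ∀ q ∈ parabolicBall _ (r / 2), ContDiffAt ℝ 1 ξ q := fun q hq =>
    contDiffAt_spatial_shift hε0 hε4 hg bg mem heq hq
  have hξd := fun q hq => (hξ q hq).differentiableAt one_ne_zero
  have bξ : ∀ q ∈ parabolicBall _ (r / 2),
      SlicewiseDerivBound ξ (4 / 3 * (2 * ε)) (4 / 3 * (ε / r)) q := fun q hq =>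
    .of_implicit hε0 hε4 (hgd _ (mem q hq)) (hξd q hq) (bg _ (mem q hq))
      (by filter_upwards [(isOpen_parabolicBall _).mem_nhds hq] with z hz using heq z hz)
  let η := fun q : EuclideanSpace ℝ (Fin n) × ℝ => h (q.1 + ξ q, q.2)
  have hη : ∀ q ∈ parabolicBall _ (r / 2), ContDiffAt ℝ 1 η q := fun q hq =>
    ContDiffAt.comp (g := h) q (hh.contDiffAt ((isOpen_parabolicBall r).mem_nhds (mem q hq)))
      ((contDiffAt_fst.add (hξ q hq)).prodMk contDiffAt_snd)
  have bη := fun q hq => SlicewiseDerivBound.comp_spatial_shift hε0 (hhd _ (mem q hq))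
    (hξd q hq) (bh _ (mem q hq)) (bξ q hq)
  refine ⟨ξ, η, fun q hq => (hξ q hq).contDiffWithinAt, fun q hq => (hη q hq).contDiffWithinAt,
    fun y t hy ht => ?_⟩
  have hq : (y, t) ∈ parabolicBall (EuclideanSpace ℝ (Fin n)) (r / 2) := ⟨hy, ht⟩
  refine ⟨?_, ?_, (mem _ hq).1, (mem _ hq).2, ?_⟩
  · have h1 : r⁻¹ * ‖ξ (y, t)‖ ≤ ε := by
      rw [inv_mul_le_iff₀ hr, heq _ hq, norm_neg]
      exact g_le _ (mem _ hq)
    have h2 := (bξ _ hq).norm_fderiv_slice_le (hξd _ hq) (by positivity)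
    have h3 : r * ‖deriv (fun s => ξ (y, s)) t‖ ≤ 4 / 3 * ε :=
      calc _ ≤ r * (4 / 3 * (ε / r)) := by
            gcongr; exact (bξ _ hq).norm_deriv_slice_le (hξd _ hq)
        _ = _ := by field_simp
    linarith
  · have hηd := (hη _ hq).differentiableAt one_ne_zero
    have h1 : r⁻¹ * ‖η (y, t)‖ ≤ ε := by
      rw [inv_mul_le_iff₀ hr]
      exact h_le _ (mem _ hq)
    have h2 := (bη _ hq).norm_fderiv_slice_le hηd (by positivity)
    have h3 : r * ‖deriv (fun s => η (y, s)) t‖ ≤ 8 / 3 * ε * ε + ε :=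
      calc _ ≤ r * (2 * ε * (4 / 3 * (ε / r)) + ε / r) := by
            gcongr; exact (bη _ hq).norm_deriv_slice_le hηd
        _ = _ := by field_simp; ring
    nlinarith
  · have hfst := heq _ hq
    refine (WithLp.equiv 2 _).injective (Prod.ext ?_ rfl)
    change y + ξ (y, t) + g (y + ξ (y, t), t) = y
    rw [add_assoc, add_eq_left, ← eq_neg_iff_add_eq_zero]
    exact hfst
end
end

section
/- Let a < b be real numbers, let μ assign to each t ∈ [a,b] a Borel measure μ(t) on ℝ^N which is finite on compact sets, and let H : [a,b] × ℝ^N → ℝ^N be measurable. Let φ : ℝ^N → [0,∞) be a twice continuously differentiable function with compact support K = spt φ, and suppose: (i) for each t ∈ [a,b] the functions x ↦ ‖H(t,x)‖² φ(x) and x ↦ ⟨H(t,x), ∇φ(x)⟩ are μ(t)-integrable, and t ↦ ∫ ( −‖H(t,x)‖² φ(x) + ⟨H(t,x), ∇φ(x)⟩ ) dμ(t)(x) is integrable on [a,b]; (ii) for all a ≤ s ≤ t ≤ b, μ(t)(φ) − μ(s)(φ) ≤ ∫_s^t ∫ ( −‖H(r,x)‖² φ(x) + ⟨H(r,x), ∇φ(x)⟩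 ) dμ(r)(x) dr; (iii) μ(t)(K) ≤ C₁ for all t ∈ [a,b]. Then the function t ↦ μ(t)(φ) − (1/2)·C₁·(sup_{ℝ^N} ‖D²φ‖)·t is nonincreasing on [a,b]. -/
open MeasureTheory
open scoped RealInnerProductSpace

noncomputable section

/-- Second-order Taylor upper bound for a `C²` function with bounded Hessian. -/
theorem ContDiff.le_add_fderiv_add_sq {E : Type*} [NormedAddCommGroup E] [NormedSpace ℝ E]
    {f : E → ℝ} (hf : ContDiff ℝ 2 f) {M : ℝ} (hM : ∀ x, ‖fderiv ℝ (fderiv ℝ f) x‖ ≤ M)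
    (x v : E) : f (x + v) ≤ f x + fderiv ℝ f x v + M / 2 * ‖v‖ ^ 2 := by
  have hdiff : Differentiable ℝ f := hf.differentiable (by norm_num)
  have hdiff' : Differentiable ℝ (fderiv ℝ f) :=
    (hf.fderiv_right (m := 1) (by norm_num)).differentiable (by norm_num)
  have hlip (y : E) : ‖fderiv ℝ f y - fderiv ℝ f x‖ ≤ M * ‖y - x‖ :=
    convex_univ.norm_image_sub_le_of_norm_fderiv_le (fun z _ => hdiff' z)
      (fun z _ => hM z) (Set.mem_univ x) (Set.mem_univ y)
  let h : ℝ → ℝ := fun t => f (x + t • v) - t * fderiv ℝ f x v - M / 2 * ‖v‖ ^ 2 * t ^ 2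
  have hderiv (t : ℝ) : HasDerivAt h
      (fderiv ℝ f (x + t • v) v - fderiv ℝ f x v - M * ‖v‖ ^ 2 * t) t := by
    have hline : HasDerivAt (fun t : ℝ => x + t • v) v t := by
      simpa using ((hasDerivAt_id t).smul_const v).const_add x
    have hcomp := (hdiff (x + t • v)).hasFDerivAt.comp_hasDerivAt t hline
    have hlin := (hasDerivAt_id t).mul_const (fderiv ℝ f x v)
    have hquad := (hasDerivAt_pow 2 t).const_mul (M / 2 * ‖v‖ ^ 2)
    refine ((hcomp.sub hlin).sub hquad).congr_deriv ?_
    norm_num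
    ring
  have hanti : AntitoneOn h (Set.Icc 0 1) := by
    refine antitoneOn_of_deriv_nonpos (convex_Icc 0 1)
      (fun t _ => (hderiv t).continuousAt.continuousWithinAt)
      (fun t _ => (hderiv t).differentiableAt.differentiableWithinAt) fun t ht => ?_
    rw [interior_Icc] at ht
    rw [(hderiv t).deriv]
    have hbound : fderiv ℝ f (x + t • v) v - fderiv ℝ f x v ≤ M * (t * ‖v‖) * ‖v‖ := by
      calc fderiv ℝ f (x + t • v) v - fderiv ℝ f x v
          ≤ ‖(fderiv ℝ f (x + t • v) - fderiv ℝ f x) v‖ := le_abs_self _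
        _ ≤ ‖fderiv ℝ f (x + t • v) - fderiv ℝ f x‖ * ‖v‖ :=
            ContinuousLinearMap.le_opNorm _ _
        _ ≤ M * (t * ‖v‖) * ‖v‖ := by
            gcongr
            simpa [norm_smul, abs_of_pos ht.1] using hlip (x + t • v)
    linarith
  have hle := hanti (Set.left_mem_Icc.2 zero_le_one) (Set.right_mem_Icc.2 zero_le_one)
    zero_le_one
  simp only [h, one_smul, zero_smul, add_zero] at hle
  linarith

/-- The gradient of a nonnegative `C²` function with Hessian bounded by `M` satisfies
`‖∇f‖² ≤ 2 M f`. -/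
theorem ContDiff.norm_gradient_sq_le {E : Type*} [NormedAddCommGroup E]
    [InnerProductSpace ℝ E] [CompleteSpace E] {f : E → ℝ} (hf : ContDiff ℝ 2 f)
    (hf0 : ∀ x, 0 ≤ f x) {M : ℝ} (hM : ∀ x, ‖fderiv ℝ (fderiv ℝ f) x‖ ≤ M) (x : E) :
    ‖gradient f x‖ ^ 2 ≤ 2 * M * f x := by
  have hM0 : 0 ≤ M := (norm_nonneg (fderiv ℝ (fderiv ℝ f) x)).trans (hM x)
  have hgrad : fderiv ℝ f x (gradient f x) = ‖gradient f x‖ ^ 2 := by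
    rw [← real_inner_self_eq_norm_sq, gradient, InnerProductSpace.toDual_symm_apply]
  have hquad (s : ℝ) : 0 ≤ M / 2 * ‖gradient f x‖ ^ 2 * (s * s)
      + -‖gradient f x‖ ^ 2 * s + f x := by
    have h := hf.le_add_fderiv_add_sq hM x (-s • gradient f x)
    rw [map_smul, hgrad, norm_smul, mul_pow, Real.norm_eq_abs, sq_abs, smul_eq_mul] at h
    nlinarith [hf0 (x + -s • gradient f x)]
  have hdisc := discrim_le_zero hquad
  rw [discrim] at hdisc
  rcases (sq_nonneg ‖gradient f x‖).eq_or_lt with hzero | hpos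
  · rw [← hzero]
    exact mul_nonneg (by positivity) (hf0 x)
  · refine le_of_mul_le_mul_right ?_ hpos
    nlinarith

/-- The Brakke integrand is bounded above by half the Hessian bound. -/
theorem ContDiff.neg_norm_sq_mul_add_inner_gradient_le {E : Type*} [NormedAddCommGroup E]
    [InnerProductSpace ℝ E] [CompleteSpace E] {f : E → ℝ} (hf : ContDiff ℝ 2 f)
    (hf0 : ∀ x, 0 ≤ f x) {M : ℝ} (hM : ∀ x, ‖fderiv ℝ (fderiv ℝ f) x‖ ≤ M) (x w : E) :
    -‖w‖ ^ 2 * f x + ⟪w, gradient f x⟫ ≤ M / 2 := by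
  have hM0 : 0 ≤ M := (norm_nonneg (fderiv ℝ (fderiv ℝ f) x)).trans (hM x)
  have hgrad := hf.norm_gradient_sq_le hf0 hM x
  have hinner := real_inner_le_norm w (gradient f x)
  rcases (hf0 x).eq_or_lt with hzero | hpos
  · have hnorm : ‖gradient f x‖ = 0 := by
      rw [← hzero, mul_zero] at hgrad
      exact pow_eq_zero_iff two_ne_zero |>.1 (le_antisymm hgrad (sq_nonneg _))
    rw [hnorm] at hinner
    rw [← hzero]
    linarith
  · refine le_of_mul_le_mul_right ?_ hpos
    nlinarith [sq_nonneg (2 * (‖w‖ * f x) - ‖gradient f x‖),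
      mul_le_mul_of_nonneg_right hinner hpos.le]

/-- Semi-decreasing mass (part A): if `t ↦ μ(t)` satisfies the Brakke inequality for the
fixed nonnegative compactly supported C² test function `φ` (with curvature `H`), and
`μ(t)(spt φ) ≤ C₁` on `[a,b]`, then `t ↦ μ(t)(φ) − (1/2) C₁ (sup ‖D²φ‖) t` is
nonincreasing on `[a,b]`. -/
theorem stmt_13 (N : ℕ) (a b : ℝ) (hab : a < b)
    (μ : ℝ → Measure (EuclideanSpace ℝ (Fin N)))
    (hfin : ∀ t ∈ Set.Icc a b, ∀ K : Set (EuclideanSpace ℝ (Fin N)),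
      IsCompact K → μ t K < ⊤)
    (H : ℝ → EuclideanSpace ℝ (Fin N) → EuclideanSpace ℝ (Fin N))
    (hH : Measurable (Function.uncurry H))
    (φ : EuclideanSpace ℝ (Fin N) → ℝ)
    (hφ : ContDiff ℝ 2 φ) (hφc : HasCompactSupport φ) (hφ0 : ∀ x, 0 ≤ φ x)
    (C₁ : ℝ) (hC₁ : 0 ≤ C₁)
    (hint : ∀ t ∈ Set.Icc a b,
      Integrable (fun x => ‖H t x‖ ^ 2 * φ x) (μ t) ∧
      Integrable (fun x => ⟪H t x, gradient φ x⟫) (μ t))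
    (hint2 : IntegrableOn
      (fun t => ∫ x, (-‖H t x‖ ^ 2 * φ x + ⟪H t x, gradient φ x⟫) ∂(μ t)) (Set.Icc a b))
    (hbrakke : ∀ s t : ℝ, a ≤ s → s ≤ t → t ≤ b →
      (∫ x, φ x ∂(μ t)) - (∫ x, φ x ∂(μ s))
        ≤ ∫ τ in s..t, ∫ x, (-‖H τ x‖ ^ 2 * φ x + ⟪H τ x, gradient φ x⟫) ∂(μ τ))
    (hmass : ∀ t ∈ Set.Icc a b, μ t (tsupport φ) ≤ ENNReal.ofReal C₁) :
    AntitoneOn (fun t =>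
      (∫ x, φ x ∂(μ t)) - (1 / 2) * C₁ * (⨆ x, ‖iteratedFDeriv ℝ 2 φ x‖) * t)
      (Set.Icc a b) := by
  set M : ℝ := ⨆ x, ‖iteratedFDeriv ℝ 2 φ x‖
  have hnorm (x : EuclideanSpace ℝ (Fin N)) :
      ‖fderiv ℝ (fderiv ℝ φ) x‖ = ‖iteratedFDeriv ℝ 2 φ x‖ := by
    rw [← norm_iteratedFDeriv_one, norm_iteratedFDeriv_fderiv]
  have hbdd : BddAbove (Set.range fun x => ‖iteratedFDeriv ℝ 2 φ x‖) :=
    ((hφ.continuous_iteratedFDeriv le_rfl).norm).bddAbove_range_of_hasCompactSupport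
      (hφc.iteratedFDeriv 2).norm
  have hM (x : EuclideanSpace ℝ (Fin N)) : ‖fderiv ℝ (fderiv ℝ φ) x‖ ≤ M :=
    (hnorm x).trans_le (le_ciSup hbdd x)
  have hM0 : 0 ≤ M := (norm_nonneg (fderiv ℝ (fderiv ℝ φ) 0)).trans (hM 0)
  have hslice : ∀ t ∈ Set.Icc a b,
      ∫ x, (-‖H t x‖ ^ 2 * φ x + ⟪H t x, gradient φ x⟫) ∂(μ t) ≤ 1 / 2 * C₁ * M := by
    intro t ht
    have hK : MeasurableSet (tsupport φ) := (isClosed_tsupport φ).measurableSet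
    have hreal : (μ t).real (tsupport φ) ≤ C₁ :=
      ENNReal.toReal_le_of_le_ofReal hC₁ (hmass t ht)
    calc ∫ x, (-‖H t x‖ ^ 2 * φ x + ⟪H t x, gradient φ x⟫) ∂(μ t)
        ≤ ∫ x, (tsupport φ).indicator (fun _ => M / 2) x ∂(μ t) := by
          refine integral_mono ?_ ?_ fun x => ?_
          · simp only [neg_mul]
            exact (hint t ht).1.neg.add (hint t ht).2
          · exact (integrable_indicator_iff hK).2 (integrableOn_const (hfin t ht _ hφc).ne)
          · by_cases hx : x ∈ tsupport φ
            · simpa only [Set.indicator_of_mem hx] using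
                hφ.neg_norm_sq_mul_add_inner_gradient_le hφ0 hM x (H t x)
            · have hφx : φ x = 0 := image_eq_zero_of_notMem_tsupport hx
              have hdx : fderiv ℝ φ x = 0 := by
                by_contra hne
                exact hx (support_fderiv_subset ℝ hne)
              simp [Set.indicator_of_notMem hx, hφx, gradient, hdx]
      _ = (μ t).real (tsupport φ) * (M / 2) := by
          rw [integral_indicator_const _ hK, smul_eq_mul]
      _ ≤ C₁ * (M / 2) := by gcongr
      _ = 1 / 2 * C₁ * M := by ring
  intro s hs t ht hst
  have hsub : Set.Icc s t ⊆ Set.Icc a b := Set.Icc_subset_Icc hs.1 ht.2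
  have htime : ∫ τ in s..t, ∫ x, (-‖H τ x‖ ^ 2 * φ x + ⟪H τ x, gradient φ x⟫) ∂(μ τ)
      ≤ ∫ _ in s..t, 1 / 2 * C₁ * M :=
    intervalIntegral.integral_mono_on hst
      ((intervalIntegrable_iff_integrableOn_Icc_of_le hst).2 (hint2.mono_set hsub))
      intervalIntegrable_const fun τ hτ => hslice τ (hsub hτ)
  rw [intervalIntegral.integral_const, smul_eq_mul] at htime
  have := hbrakke s t hs.1 hst ht.2
  dsimp only
  linarith
end
end

section
/- Let a < b be real numbers, let μ assign to each t ∈ [a,b] a Borel measure μ(t) on ℝ^N which is finite on compact sets, and let H : [a,b] × ℝ^N → ℝ^N be measurable. Let φ : ℝ^N → [0,∞) be a twice continuously differentiable function with compact support K = spt φ, and suppose: (i) for each t ∈ [a,b] the functions x ↦ ‖H(t,x)‖² φ(x) and x ↦ ⟨H(t,x), ∇φ(x)⟩ are μ(t)-integrable, and t ↦ ∫ ( −‖H(t,x)‖² φ(x) + ⟨H(t,x), ∇φ(x)⟩ ) dμ(t)(x) is integrable on [a,b]; (ii) for all a ≤ s ≤ t ≤ b, μ(t)(φ) − μ(s)(φ)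 ≤ ∫_s^t ∫ ( −‖H(r,x)‖² φ(x) + ⟨H(r,x), ∇φ(x)⟩ ) dμ(r)(x) dr; (iii) μ(t)(K) ≤ C₁ for all t ∈ [a,b]. Then ∫_a^b ∫ ‖H(t,x)‖² φ(x) dμ(t)(x) dt ≤ 2 μ(a)(φ) + 2 (b−a)·C₁·sup_{ℝ^N} ‖D²φ‖. -/
open MeasureTheory
open scoped RealInnerProductSpace

noncomputable section

open scoped Gradient

section GradientBound

variable {E : Type*} [NormedAddCommGroup E] [NormedSpace ℝ E]

/-- The quadratic upper bound for a function whose derivative is `L`-Lipschitz. -/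
lemma le_add_fderiv_add_sq_of_lipschitz {f : E → ℝ} {L : ℝ}
    (hf : Differentiable ℝ f) (hL : ∀ x y, ‖fderiv ℝ f y - fderiv ℝ f x‖ ≤ L * ‖y - x‖)
    (x v : E) : f (x + v) ≤ f x + fderiv ℝ f x v + L / 2 * ‖v‖ ^ 2 := by
  set h : ℝ → ℝ := fun t => f (x + t • v) - t * fderiv ℝ f x v - L / 2 * ‖v‖ ^ 2 * t ^ 2 with hh
  have hd : ∀ t, HasDerivAt h
      (fderiv ℝ f (x + t • v) v - fderiv ℝ f x v - L / 2 * ‖v‖ ^ 2 * (2 * t)) t := by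
    intro t
    have h1 : HasDerivAt (fun t : ℝ => x + t • v) v t := by
      simpa using ((hasDerivAt_id t).smul_const v).const_add x
    have h2 := (hf (x + t • v)).hasFDerivAt.comp_hasDerivAt t h1
    have h3 := (hasDerivAt_id t).mul_const (fderiv ℝ f x v)
    have h4 := ((hasDerivAt_id t).pow 2).const_mul (L / 2 * ‖v‖ ^ 2)
    refine ((h2.sub h3).sub h4).congr_deriv ?_
    simp
  have hanti : AntitoneOn h (Set.Icc 0 1) := by
    refine antitoneOn_of_deriv_nonpos (convex_Icc 0 1)
      (fun t _ => (hd t).continuousAt.continuousWithinAt)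
      (fun t _ => (hd t).differentiableAt.differentiableWithinAt) fun t ht => ?_
    rw [interior_Icc] at ht
    rw [(hd t).deriv]
    have h1 : fderiv ℝ f (x + t • v) v - fderiv ℝ f x v ≤ L * ‖t • v‖ * ‖v‖ := by
      rw [← sub_apply]
      refine (Real.le_norm_self _).trans ((ContinuousLinearMap.le_opNorm _ _).trans ?_)
      gcongr
      simpa using hL x (x + t • v)
    rw [norm_smul, Real.norm_of_nonneg ht.1.le] at h1
    linarith
  have := hanti (Set.left_mem_Icc.2 zero_le_one) (Set.right_mem_Icc.2 zero_le_one) zero_le_one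
  simp only [hh, one_smul, zero_smul, add_zero] at this
  linarith

/-- The derivative of a `C²` function is Lipschitz with constant any bound on the Hessian. -/
lemma norm_fderiv_sub_le_of_iteratedFDeriv_two_le {f : E → ℝ} {L : ℝ} (hf : ContDiff ℝ 2 f)
    (hL : ∀ x, ‖iteratedFDeriv ℝ 2 f x‖ ≤ L) (x y : E) :
    ‖fderiv ℝ f y - fderiv ℝ f x‖ ≤ L * ‖y - x‖ := by
  have hdiff : Differentiable ℝ (fderiv ℝ f) :=
    (hf.fderiv_right (m := 1) (by norm_num)).differentiable (by norm_num)
  refine convex_univ.norm_image_sub_le_of_norm_fderiv_le (𝕜 := ℝ) (fun z _ => hdiff z)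
    (fun z _ => ?_) (Set.mem_univ x) (Set.mem_univ y)
  rw [← norm_iteratedFDeriv_one, norm_iteratedFDeriv_fderiv]
  exact hL z

end GradientBound

section InnerProduct

variable {E : Type*} [NormedAddCommGroup E] [InnerProductSpace ℝ E] [CompleteSpace E]

/-- A nonnegative `C²` function satisfies `‖∇f‖² ≤ 2 f sup ‖D²f‖`. -/
lemma norm_gradient_sq_le_of_nonneg {f : E → ℝ} {L : ℝ} (hf : ContDiff ℝ 2 f)
    (hf0 : ∀ x, 0 ≤ f x) (hL : ∀ x, ‖iteratedFDeriv ℝ 2 f x‖ ≤ L) (x : E) :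
    ‖∇ f x‖ ^ 2 ≤ 2 * L * f x := by
  have hL0 : 0 ≤ L := (norm_nonneg _).trans (hL x)
  have key : ∀ s : ℝ, 0 ≤ L / 2 * ‖∇ f x‖ ^ 2 * (s * s) + ‖∇ f x‖ ^ 2 * s + f x := by
    intro s
    have h1 := le_add_fderiv_add_sq_of_lipschitz (hf.differentiable (by norm_num))
      (norm_fderiv_sub_le_of_iteratedFDeriv_two_le hf hL) x (s • ∇ f x)
    have h2 : fderiv ℝ f x (∇ f x) = ‖∇ f x‖ ^ 2 := by
      rw [← real_inner_self_eq_norm_sq]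
      exact (InnerProductSpace.toDual_symm_apply (𝕜 := ℝ)).symm
    rw [map_smul, h2, norm_smul, mul_pow, Real.norm_eq_abs, sq_abs, smul_eq_mul] at h1
    linarith [hf0 (x + s • ∇ f x)]
  have hdisc := discrim_le_zero key
  rw [discrim] at hdisc
  rcases (sq_nonneg ‖∇ f x‖).eq_or_lt with h0 | h0
  · rw [← h0]
    exact mul_nonneg (by positivity) (hf0 x)
  · refine le_of_mul_le_mul_left ?_ h0
    linarith

/-- Young's inequality for the transport term of the Brakke inequality. -/
lemma inner_gradient_le_of_nonneg {f : E → ℝ} {L : ℝ} (hf : ContDiff ℝ 2 f)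
    (hf0 : ∀ x, 0 ≤ f x) (hL : ∀ x, ‖iteratedFDeriv ℝ 2 f x‖ ≤ L) (v x : E) :
    ⟪v, ∇ f x⟫ ≤ ‖v‖ ^ 2 * f x / 2 + (tsupport f).indicator (fun _ => L) x := by
  by_cases hx : x ∈ tsupport f
  · have hL0 : 0 ≤ L := (norm_nonneg _).trans (hL x)
    rw [Set.indicator_of_mem hx]
    refine (real_inner_le_norm _ _).trans (abs_le_of_sq_le_sq' ?_ ?_).2
    · have := mul_le_mul_of_nonneg_left (norm_gradient_sq_le_of_nonneg hf hf0 hL x)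
        (sq_nonneg ‖v‖)
      nlinarith [sq_nonneg (‖v‖ ^ 2 * f x / 2 - L)]
    · have := hf0 x
      positivity
  · have h0 : fderiv ℝ f x = 0 :=
      Function.notMem_support.1 fun h => hx (support_fderiv_subset ℝ h)
    simp only [gradient, h0, map_zero, inner_zero_right, Set.indicator_of_notMem hx, add_zero]
    have := hf0 x
    positivity

end InnerProduct

/-- The Hessian norm of a compactly supported `C²` function is bounded. -/
lemma bddAbove_norm_iteratedFDeriv_two_of_hasCompactSupport {E : Type*}
    [NormedAddCommGroup E] [NormedSpace ℝ E] {f : E → ℝ} (hf : ContDiff ℝ 2 f) (hc : HasCompactSupport f) :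
    BddAbove (Set.range fun x => ‖iteratedFDeriv ℝ 2 f x‖) := by
  obtain ⟨C, hC⟩ := (hf.continuous_iteratedFDeriv le_rfl).bounded_above_of_compact_support
    (hc.iteratedFDeriv 2)
  exact ⟨C, Set.forall_mem_range.2 hC⟩

/-- Semi-decreasing mass (part C): if `t ↦ μ(t)` satisfies the Brakke inequality for the
fixed nonnegative compactly supported C² test function `φ` (with curvature `H`), and
`μ(t)(spt φ) ≤ C₁` on `[a,b]`, then the spacetime curvature integral satisfies
`∫_a^b ∫ ‖H‖² φ dμ(t) dt ≤ 2 μ(a)(φ) + 2(b−a) C₁ sup ‖D²φ‖`. -/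
theorem stmt_14 (N : ℕ) (a b : ℝ) (hab : a < b)
    (μ : ℝ → Measure (EuclideanSpace ℝ (Fin N)))
    (hfin : ∀ t ∈ Set.Icc a b, ∀ K : Set (EuclideanSpace ℝ (Fin N)),
      IsCompact K → μ t K < ⊤)
    (H : ℝ → EuclideanSpace ℝ (Fin N) → EuclideanSpace ℝ (Fin N))
    (hH : Measurable (Function.uncurry H))
    (φ : EuclideanSpace ℝ (Fin N) → ℝ)
    (hφ : ContDiff ℝ 2 φ) (hφc : HasCompactSupport φ) (hφ0 : ∀ x, 0 ≤ φ x)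
    (C₁ : ℝ) (hC₁ : 0 ≤ C₁)
    (hint : ∀ t ∈ Set.Icc a b,
      Integrable (fun x => ‖H t x‖ ^ 2 * φ x) (μ t) ∧
      Integrable (fun x => ⟪H t x, gradient φ x⟫) (μ t))
    (hint2 : IntegrableOn
      (fun t => ∫ x, (-‖H t x‖ ^ 2 * φ x + ⟪H t x, gradient φ x⟫) ∂(μ t)) (Set.Icc a b))
    (hbrakke : ∀ s t : ℝ, a ≤ s → s ≤ t → t ≤ b →
      (∫ x, φ x ∂(μ t)) - (∫ x, φ x ∂(μ s))
        ≤ ∫ τ in s..t, ∫ x, (-‖H τ x‖ ^ 2 * φ x + ⟪H τ x, gradient φ x⟫) ∂(μ τ))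
    (hmass : ∀ t ∈ Set.Icc a b, μ t (tsupport φ) ≤ ENNReal.ofReal C₁) :
    (∫ t in a..b, ∫ x, ‖H t x‖ ^ 2 * φ x ∂(μ t))
      ≤ 2 * (∫ x, φ x ∂(μ a))
        + 2 * (b - a) * C₁ * (⨆ x, ‖iteratedFDeriv ℝ 2 φ x‖) := by
  set L : ℝ := ⨆ x, ‖iteratedFDeriv ℝ 2 φ x‖ with hLdef
  have hL : ∀ x, ‖iteratedFDeriv ℝ 2 φ x‖ ≤ L :=
    le_ciSup (bddAbove_norm_iteratedFDeriv_two_of_hasCompactSupport hφ hφc)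
  have hL0 : 0 ≤ L := (norm_nonneg _).trans (hL 0)
  have hmass_nonneg : ∀ t, 0 ≤ ∫ x, φ x ∂(μ t) := fun t => integral_nonneg hφ0
  have hba : 0 ≤ b - a := sub_nonneg.2 hab.le
  by_cases hA : IntervalIntegrable (fun t => ∫ x, ‖H t x‖ ^ 2 * φ x ∂(μ t)) volume a b
  swap
  · rw [intervalIntegral.integral_undef hA]
    have := hmass_nonneg a
    positivity
  have hK : MeasurableSet (tsupport φ) := (isClosed_tsupport φ).measurableSet
  have hslice : ∀ t ∈ Set.Icc a b,
      ∫ x, (-‖H t x‖ ^ 2 * φ x + ⟪H t x, gradient φ x⟫) ∂(μ t)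
        ≤ -(1 / 2) * (∫ x, ‖H t x‖ ^ 2 * φ x ∂(μ t)) + C₁ * L := by
    intro t ht
    obtain ⟨hi1, hi2⟩ := hint t ht
    have hKfin : μ t (tsupport φ) ≠ ⊤ := (hfin t ht _ hφc).ne
    have hind : Integrable ((tsupport φ).indicator fun _ => L) (μ t) :=
      (integrable_indicator_iff hK).2 (integrableOn_const hKfin)
    have hi1' : Integrable (fun x => -‖H t x‖ ^ 2 * φ x) (μ t) := by
      simpa only [neg_mul] using hi1.fun_neg
    have hKreal : (μ t).real (tsupport φ) ≤ C₁ :=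
      ENNReal.toReal_le_of_le_ofReal hC₁ (hmass t ht)
    calc ∫ x, (-‖H t x‖ ^ 2 * φ x + ⟪H t x, gradient φ x⟫) ∂(μ t)
        ≤ ∫ x, (-(1 / 2) * (‖H t x‖ ^ 2 * φ x)
            + (tsupport φ).indicator (fun _ => L) x) ∂(μ t) := by
          refine integral_mono (hi1'.add hi2) ((hi1.const_mul _).add hind) fun x => ?_
          have := inner_gradient_le_of_nonneg hφ hφ0 hL (H t x) x
          simp only
          linarith
      _ = -(1 / 2) * (∫ x, ‖H t x‖ ^ 2 * φ x ∂(μ t)) + (μ t).real (tsupport φ) * L := by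
          rw [integral_add (hi1.const_mul _) hind, integral_const_mul,
            integral_indicator_const _ hK, smul_eq_mul]
      _ ≤ _ := by gcongr
  have hB : IntervalIntegrable
      (fun t => ∫ x, (-‖H t x‖ ^ 2 * φ x + ⟪H t x, gradient φ x⟫) ∂(μ t)) volume a b :=
    (intervalIntegrable_iff_integrableOn_Icc_of_le hab.le).2 hint2
  have hmono := intervalIntegral.integral_mono_on hab.le hB
    ((hA.const_mul (-(1 / 2))).add intervalIntegrable_const) hslice
  rw [intervalIntegral.integral_add (hA.const_mul _) intervalIntegrable_const,
    intervalIntegral.integral_const_mul, intervalIntegral.integral_const, smul_eq_mul] at hmono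
  linarith [hbrakke a b le_rfl hab.le le_rfl, hmass_nonneg b]
end
end
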